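/- arXiv:1602.03394 — 2 statements merged into one kernel-verified Lean document; each statement's English description precedes it below -/
import Mathlib

section
/- Let G be a finite metric graph and let λ > 0. Then the dimension of the resonance eigenspace satisfies dim R(G, λ) = β₁(G_λ) − β₀^odd(G_λ). In particular, λ is a resonance of G if and only if β₁(G_λ) > β₀^odd(G_λ). -/
open Real Set Filter Topology

noncomputable section

/-- A finite metric graph: finite vertex and edge sets, each edge `e` has an initial
vertex `o e`, a terminal vertex `t e` and a positive length `L e`, and is identified
with the interval `[0, L e]`.  Every vertex is an endpoint of some edge. -/
structure MetricGraph where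
  V : Type
  E : Type
  [fintV : Fintype V]
  [fintE : Fintype E]
  [decV : DecidableEq V]
  [decE : DecidableEq E]
  o : E → V
  t : E → V
  L : E → ℝ
  L_pos : ∀ e, 0 < L e
  noIsolated : ∀ v, ∃ e, o e = v ∨ t e = v

attribute [instance] MetricGraph.fintV MetricGraph.fintE MetricGraph.decV MetricGraph.decE

namespace MetricGraph

variable (G : MetricGraph)

/-- The source vertex of edge `e` traversed in direction `d`. -/
def esrc (e : G.E) (d : Bool) : G.V := if d then G.o e else G.t e

/-- The destination vertex of edge `e` traversed in direction `d`. -/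
def edst (e : G.E) (d : Bool) : G.V := if d then G.t e else G.o e

/-- A cycle in a metric graph: a closed walk which uses no edge twice and repeats no
vertex except that its initial and terminal vertices coincide. -/
structure Cycle where
  n : ℕ
  npos : 0 < n
  edge : Fin n → G.E
  dir : Fin n → Bool
  edge_inj : Function.Injective edge
  vert_inj : Function.Injective fun i => G.esrc (edge i) (dir i)
  chain : ∀ i : Fin n,
    G.edst (edge i) (dir i) =
      G.esrc (edge ⟨((i : ℕ) + 1) % n, Nat.mod_lt _ npos⟩)
        (dir ⟨((i : ℕ) + 1) % n, Nat.mod_lt _ npos⟩)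

/-- The length of a cycle: the sum of the lengths of its edges. -/
def Cycle.length {G : MetricGraph} (c : G.Cycle) : ℝ := ∑ i, G.L (c.edge i)

/-- The cycle `c` lies in the subgraph given by the edge set `S`. -/
def Cycle.inSub {G : MetricGraph} (c : G.Cycle) (S : Set G.E) : Prop := ∀ i, c.edge i ∈ S

/-- The cycle `c` has odd length with respect to `x`: its length is an odd multiple of `x`. -/
def Cycle.oddLength {G : MetricGraph} (c : G.Cycle) (x : ℝ) : Prop :=
  ∃ m : ℕ, Odd m ∧ c.length = m * x

/-- The initial vertex of a cycle. -/
def Cycle.start {G : MetricGraph} (c : G.Cycle) : G.V :=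
  G.esrc (c.edge ⟨0, c.npos⟩) (c.dir ⟨0, c.npos⟩)

/-- The vertices incident to an edge of the edge set `S`, i.e. the vertex set of the
subgraph generated by `S`. -/
def incVerts (S : Set G.E) : Set G.V := {v | ∃ e ∈ S, G.o e = v ∨ G.t e = v}

/-- Two vertices are related iff they are connected through edges of `S`. -/
def connRel (S : Set G.E) : G.V → G.V → Prop :=
  Relation.EqvGen fun v w => ∃ e ∈ S, G.o e = v ∧ G.t e = w

/-- The connected component of the vertex `v` in the subgraph given by `S`. -/
def component (S : Set G.E) (v : G.V) : Set G.V := {w | G.connRel S v w}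

/-- The number of connected components of the subgraph given by the edge set `S`. -/
def beta0 (S : Set G.E) : ℕ := (G.component S '' G.incVerts S).ncard

/-- The first Betti number `|E| - |V| + β₀` of the subgraph given by the edge set `S`. -/
def beta1 (S : Set G.E) : ℤ :=
  (S.ncard : ℤ) - ((G.incVerts S).ncard : ℤ) + (G.beta0 S : ℤ)

/-- The number of connected components of the subgraph given by `S` which contain a
cycle of odd length with respect to `x`. -/
def beta0odd (S : Set G.E) (x : ℝ) : ℕ :=
  (G.component S '' {v | v ∈ G.incVerts S ∧
    ∃ c : G.Cycle, c.inSub S ∧ c.oddLength x ∧ G.connRel S v c.start}).ncard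

/-- The edge set of the subgraph `G_λ`: all edges whose length is a positive integer
multiple of `π / √λ`. -/
def lamEdges (lam : ℝ) : Set G.E :=
  {e | ∃ k : ℕ, 0 < k ∧ G.L e = k * (π / Real.sqrt lam)}

/-- An edgewise given function is continuous at all the vertices of `G`. -/
def ContVert (f : G.E → ℝ → ℂ) : Prop :=
  (∀ e₁ e₂, G.o e₁ = G.o e₂ → f e₁ 0 = f e₂ 0) ∧
  (∀ e₁ e₂, G.o e₁ = G.t e₂ → f e₁ 0 = f e₂ (G.L e₂)) ∧
  (∀ e₁ e₂, G.t e₁ = G.t e₂ → f e₁ (G.L e₁) = f e₂ (G.L e₂))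

/-- The value of an (edgewise given, vertex-continuous) function at the vertex `v`. -/
def vtxVal (f : G.E → ℝ → ℂ) (v : G.V) : ℂ :=
  if h : ∃ e, G.o e = v then f h.choose 0
  else f (G.noIsolated v).choose (G.L ((G.noIsolated v).choose))

/-- `∂_ν f (v)`: the sum of the derivatives at the vertex `v` of the restrictions of
`f` to the edges incident to `v`, all pointing towards `v`. -/
def normDer (f : G.E → ℝ → ℂ) (v : G.V) : ℂ :=
  (∑ e ∈ Finset.univ.filter fun e => G.t e = v, deriv (f e) (G.L e)) -
    ∑ e ∈ Finset.univ.filter fun e => G.o e = v, deriv (f e) 0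

/-- `f` solves `-f'' = μ f` on every edge and is continuous at the vertices.
(A solution of `-f'' = μ f` on `[0, L e]` is identified with its unique extension to a
global solution on `ℝ`.) -/
def IsSol (mu : ℂ) (f : G.E → ℝ → ℂ) : Prop :=
  (∀ e, ContDiff ℝ 2 (f e)) ∧
  (∀ e, ∀ x : ℝ, deriv (deriv (f e)) x = -mu * f e x) ∧ G.ContVert f

/-- Membership in `ker (-Δ_G - λ)` for the Kirchhoff Laplacian `-Δ_G`. -/
def InKer (lam : ℝ) (f : G.E → ℝ → ℂ) : Prop :=
  G.IsSol (lam : ℂ) f ∧ ∀ v, G.normDer f v = 0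

/-- `ker (-Δ_G - λ)` as a set of (edgewise given) functions. -/
def kerSet (lam : ℝ) : Set (G.E → ℝ → ℂ) := {f | G.InKer lam f}

/-- `λ` is an eigenvalue of the Kirchhoff Laplacian `-Δ_G`. -/
def IsEigenvalue (lam : ℝ) : Prop := G.kerSet lam ≠ {0}

/-- `dim ker (-Δ_G - λ)`. -/
def dimKer (lam : ℝ) : ℕ := Module.finrank ℂ (Submodule.span ℂ (G.kerSet lam))

/-- The resonance eigenspace `R (G, λ)`: all elements of `ker (-Δ_G - λ)` vanishing at
every vertex of `G`. -/
def resSet (lam : ℝ) : Set (G.E → ℝ → ℂ) :=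
  {f | G.InKer lam f ∧ ∀ e, f e 0 = 0 ∧ f e (G.L e) = 0}

/-- `λ` is a (real) resonance of `G` iff `R (G, λ) ≠ {0}`. -/
def IsResonance (lam : ℝ) : Prop := G.resSet lam ≠ {0}

/-- `dim R (G, λ)`. -/
def dimRes (lam : ℝ) : ℕ := Module.finrank ℂ (Submodule.span ℂ (G.resSet lam))

/-- `R_B (G, λ)`: all elements of `ker (-Δ_G - λ)` vanishing at every vertex in `B`. -/
def resSetB (B : Set G.V) (lam : ℝ) : Set (G.E → ℝ → ℂ) :=
  {f | G.InKer lam f ∧ ∀ e, (G.o e ∈ B → f e 0 = 0) ∧ (G.t e ∈ B → f e (G.L e) = 0)}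

/-- `dim R_B (G, λ)`. -/
def dimResB (B : Set G.V) (lam : ℝ) : ℕ :=
  Module.finrank ℂ (Submodule.span ℂ (G.resSetB B lam))

/-- The degree of a vertex (a loop counts twice). -/
def degree (v : G.V) : ℕ := {e | G.o e = v}.ncard + {e | G.t e = v}.ncard

/-- The degree of a vertex inside the subgraph given by the edge set `S`. -/
def degreeIn (S : Set G.E) (v : G.V) : ℕ :=
  {e | e ∈ S ∧ G.o e = v}.ncard + {e | e ∈ S ∧ G.t e = v}.ncard

/-- The edge set of the core of `G`: the largest subgraph without vertices of degree one. -/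
def coreEdges : Set G.E := ⋃₀ {S : Set G.E | ∀ v, G.degreeIn S v ≠ 1}

/-- A boundary vertex is a vertex of degree one. -/
def IsBoundaryVertex (v : G.V) : Prop := G.degree v = 1

/-- A proper core vertex: all edges attached to it belong to the core of `G`. -/
def IsProperCoreVertex (v : G.V) : Prop :=
  ∀ e, G.o e = v ∨ G.t e = v → e ∈ G.coreEdges

/-- The defining property of the function `f^{(l)}` for the Titchmarsh--Weyl matrix:
`f` solves `-f'' = μ f` edgewise, is continuous at the vertices, and satisfies
`∂_ν f (v₀) = 1` and `∂_ν f (v) = 0` for all vertices `v ≠ v₀`. -/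
def IsTWsol (mu : ℂ) (v0 : G.V) (f : G.E → ℝ → ℂ) : Prop :=
  G.IsSol mu f ∧ G.normDer f v0 = 1 ∧ ∀ v, v ≠ v0 → G.normDer f v = 0

open scoped Classical in
/-- The Titchmarsh--Weyl matrix `M_B (μ)` with entries `(M_B (μ))_{k,l} = f^{(l)} (v_k)`
(defined via choice; junk if no `f^{(l)}` exists, i.e. at the eigenvalues). -/
def TW (B : Finset G.V) (mu : ℂ) : Matrix B B ℂ :=
  Matrix.of fun k l : B => if h : ∃ f, G.IsTWsol mu l f then G.vtxVal h.choose k else 0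

/-- The cycle `c` has commensurate edges: all ratios of edge lengths are rational. -/
def Commensurate (c : G.Cycle) : Prop :=
  ∀ i j, ∃ q : ℚ, G.L (c.edge i) = q * G.L (c.edge j)

/-- `u_C`: the maximal number such that the length of each edge of the cycle `c` is a
positive integer multiple of it. -/
def uC (c : G.Cycle) : ℝ :=
  sSup {u : ℝ | 0 < u ∧ ∀ i, ∃ k : ℕ, 0 < k ∧ G.L (c.edge i) = k * u}

/-- `λ_G := inf { π²/u_C² : C a cycle in G with commensurate edges }`, with value `+∞`
if there is no cycle with commensurate edges. -/
def lamThreshold : EReal :=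
  sInf {x : EReal | ∃ c : G.Cycle, G.Commensurate c ∧ x = ((π ^ 2 / (G.uC c) ^ 2 : ℝ) : EReal)}

end MetricGraph

section MatrixFun

variable {m : Type} [Fintype m]

/-- The matrix function `M` has a pole of order `n` at `λ`:
`lim_{z → λ} (z - λ)^n M(z)` exists and is nonzero, while
`lim_{z → λ} (z - λ)^(n+1) M(z) = 0`. -/
def hasPoleOrder (M : ℂ → Matrix m m ℂ) (lam : ℂ) (n : ℕ) : Prop :=
  (∃ A : Matrix m m ℂ, A ≠ 0 ∧
    Filter.Tendsto (fun z => (z - lam) ^ n • M z) (𝓝[≠] lam) (𝓝 A)) ∧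
  Filter.Tendsto (fun z => (z - lam) ^ (n + 1) • M z) (𝓝[≠] lam) (𝓝 0)

/-- `λ` is a pole of the matrix function `M`: `M` is analytic on a punctured
neighborhood of `λ` and has a pole of some order `n ≥ 1` at `λ`. -/
def isPole (M : ℂ → Matrix m m ℂ) (lam : ℂ) : Prop :=
  (∀ᶠ z in 𝓝[≠] lam, ∀ k l, AnalyticAt ℂ (fun w => M w k l) z) ∧
  ∃ n : ℕ, 1 ≤ n ∧ hasPoleOrder M lam n

open scoped Classical in
/-- `Res_λ M := (2πi)⁻¹ ∮_Γ M(μ) dμ`, computed entrywise over a sufficiently small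
positively oriented circle `Γ` centered at `λ` (defined via choice as the common value
of the circle integrals over all sufficiently small radii). -/
def matResidue (M : ℂ → Matrix m m ℂ) (lam : ℂ) : Matrix m m ℂ :=
  Matrix.of fun k l =>
    if h : ∃ c : ℂ, ∀ᶠ R in 𝓝[>] (0 : ℝ),
        (2 * (π : ℂ) * Complex.I)⁻¹ * circleIntegral (fun z => M z k l) lam R = c
    then h.choose else 0

end MatrixFun

namespace MetricGraph

section SignedGraph

variable {G : MetricGraph} {S : Set G.E} {s : G.E → ℤˣ}

/-- `SReach S s v w x`: some walk from `v` to `w` along edges of `S` has product of edge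
signs equal to `x`. -/
inductive SReach (S : Set G.E) (s : G.E → ℤˣ) : G.V → G.V → ℤˣ → Prop
  | refl (v : G.V) : SReach S s v v 1
  | step (e : G.E) (d : Bool) {w : G.V} {x : ℤˣ} (he : e ∈ S)
      (h : SReach S s (G.edst e d) w x) : SReach S s (G.esrc e d) w (s e * x)

theorem SReach.trans {u v w : G.V} {x y : ℤˣ} (h : SReach S s u v x) (h' : SReach S s v w y) :
    SReach S s u w (x * y) := by
  induction h with
  | refl v => simpa using h'
  | step e d he _ ih => rw [mul_assoc]; exact .step e d he (ih h')

theorem SReach.edge {e : G.E} (d : Bool) (he : e ∈ S) :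
    SReach S s (G.esrc e d) (G.edst e d) (s e) := by
  simpa using SReach.step (s := s) e d he (.refl _)

theorem esrc_not (e : G.E) (d : Bool) : G.esrc e (!d) = G.edst e d := by
  cases d <;> simp [esrc, edst]

theorem edst_not (e : G.E) (d : Bool) : G.edst e (!d) = G.esrc e d := by
  cases d <;> simp [esrc, edst]

theorem SReach.symm {v w : G.V} {x : ℤˣ} (h : SReach S s v w x) : SReach S s w v x := by
  induction h with
  | refl v => exact .refl v
  | step e d he _ ih =>
    have := SReach.edge (s := s) (!d) he
    rw [esrc_not, edst_not] at this
    rw [mul_comm]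
    exact ih.trans this

theorem connRel_iff_sReach {v w : G.V} : G.connRel S v w ↔ ∃ x, SReach S s v w x := by
  constructor
  · intro h
    induction h with
    | rel v w h =>
      obtain ⟨e, he, rfl, rfl⟩ := h
      exact ⟨_, SReach.edge true he⟩
    | refl v => exact ⟨1, .refl v⟩
    | symm v w _ ih => exact ih.imp fun _ h => h.symm
    | trans u v w _ _ ih ih' =>
      obtain ⟨x, hx⟩ := ih
      obtain ⟨y, hy⟩ := ih'
      exact ⟨_, hx.trans hy⟩
  · rintro ⟨x, h⟩
    induction h with
    | refl v => exact .refl v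
    | step e d he _ ih =>
      refine .trans _ _ _ ?_ ih
      cases d
      · exact .symm _ _ (.rel _ _ ⟨e, he, by simp [edst, esrc]⟩)
      · exact .rel _ _ ⟨e, he, by simp [edst, esrc]⟩

theorem component_eq_iff {v w : G.V} : G.component S v = G.component S w ↔ G.connRel S v w := by
  constructor
  · intro h
    have : w ∈ G.component S w := .refl w
    rwa [← h] at this
  · intro h
    ext u
    exact ⟨fun hu => .trans _ _ _ (.symm _ _ h) hu, fun hu => .trans _ _ _ h hu⟩

/-- The vertex `v` lies in a balanced component: no closed walk at `v` has sign `-1`. -/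
def Balanced (S : Set G.E) (s : G.E → ℤˣ) (v : G.V) : Prop := ¬ SReach S s v v (-1)

theorem SReach.balanced_iff {v w : G.V} {x : ℤˣ} (h : SReach S s v w x) :
    Balanced S s v ↔ Balanced S s w := by
  have key : ∀ {v w}, SReach S s v w x → SReach S s v v (-1) → SReach S s w w (-1) := by
    intro v w h hv
    have := (h.symm.trans hv).trans h
    rwa [mul_right_comm, Int.units_mul_self, one_mul] at this
  exact not_congr ⟨key h, key h.symm⟩

theorem SReach.sign_unique {v w : G.V} {x y : ℤˣ} (hv : Balanced S s v)
    (hx : SReach S s v w x) (hy : SReach S s v w y) : x = y := by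
  by_contra hne
  apply hv
  have := hx.trans hy.symm
  rcases Int.units_eq_one_or x with rfl | rfl <;> rcases Int.units_eq_one_or y with rfl | rfl <;>
    simp_all

theorem SReach.eq_of_notMem_incVerts {v w : G.V} {x : ℤˣ} (h : SReach S s v w x)
    (hv : v ∉ G.incVerts S) : w = v ∧ x = 1 := by
  cases h with
  | refl => exact ⟨rfl, rfl⟩
  | step e d he _ =>
    refine absurd ⟨e, he, ?_⟩ hv
    cases d <;> simp [esrc]

/-- The edges `e 0, …, e (n - 1)` of `S`, traversed in directions `d`, form a walk with
vertices `p 0, …, p n`. -/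
def IsWalk (S : Set G.E) (n : ℕ) (p : ℕ → G.V) (e : ℕ → G.E) (d : ℕ → Bool) : Prop :=
  ∀ i < n, e i ∈ S ∧ G.esrc (e i) (d i) = p i ∧ G.edst (e i) (d i) = p (i + 1)

theorem IsWalk.sReach {n : ℕ} {p : ℕ → G.V} {e : ℕ → G.E} {d : ℕ → Bool}
    (h : IsWalk S n p e d) : SReach S s (p 0) (p n) (∏ i ∈ Finset.range n, s (e i)) := by
  induction n with
  | zero => exact .refl _
  | succ n ih =>
    rw [Finset.prod_range_succ]
    refine (ih fun i hi => h i (by omega)).trans ?_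
    obtain ⟨h1, h2, h3⟩ := h n (by omega)
    rw [← h2, ← h3]
    exact .edge _ h1

theorem SReach.exists_isWalk [Nonempty G.E] {v w : G.V} {x : ℤˣ} (h : SReach S s v w x) :
    ∃ n p e d, IsWalk S n p e d ∧ p 0 = v ∧ p n = w ∧ ∏ i ∈ Finset.range n, s (e i) = x := by
  induction h with
  | refl v =>
    exact ⟨0, fun _ => v, fun _ => Classical.arbitrary _, fun _ => true,
      fun i hi => absurd hi (Nat.not_lt_zero _), rfl, rfl, rfl⟩
  | step e₀ d₀ he _ ih =>
    obtain ⟨n, p, e, d, hw, h0, hn, hx⟩ := ih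
    refine ⟨n + 1, fun i => Nat.casesOn i (G.esrc e₀ d₀) p, fun i => Nat.casesOn i e₀ e,
      fun i => Nat.casesOn i d₀ d, ?_, rfl, hn, ?_⟩
    · rintro (_ | i) hi
      · exact ⟨he, rfl, h0.symm⟩
      · exact hw i (by omega)
    · rw [Finset.prod_range_succ', mul_comm]
      simp [hx]

theorem IsWalk.edge_inj {n : ℕ} {p : ℕ → G.V} {e : ℕ → G.E} {d : ℕ → Bool}
    (h : IsWalk S n p e d) (hp : p n = p 0) (hs : ∏ i ∈ Finset.range n, s (e i) = -1)
    (hinj : ∀ i j, i < j → j < n → p i ≠ p j) : ∀ i j, i < j → j < n → e i ≠ e j := by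
  intro i j hij hj he
  obtain ⟨-, hi1, hi2⟩ := h i (by omega)
  obtain ⟨-, hj1, hj2⟩ := h j hj
  rw [← he] at hj1 hj2
  by_cases hd : d j = d i
  · rw [hd] at hj1
    exact hinj i j hij hj (hi1.symm.trans hj1)
  · have hd' : d j = !d i := by cases h1 : d j <;> cases h2 : d i <;> simp_all
    rw [hd', esrc_not] at hj1
    rw [hd', edst_not] at hj2
    have h1 : p (i + 1) = p j := hi2.symm.trans hj1
    have h2 : p (j + 1) = p i := hj2.symm.trans hi1
    have hji : j = i + 1 := by
      by_contra hne
      exact hinj (i + 1) j (by omega) hj h1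
    have hjn : j + 1 = n := by
      by_contra hne
      exact hinj i (j + 1) (by omega) (by omega) h2.symm
    have hi0 : i = 0 := by
      by_contra hne
      rw [hjn, hp] at h2
      exact hinj 0 i (by omega) (by omega) h2
    subst hi0 hji hjn
    simp [Finset.prod_range_succ, ← he] at hs

/-- A closed walk of sign `-1` contains a cycle of sign `-1`. -/
theorem IsWalk.exists_cycle {n : ℕ} {p : ℕ → G.V} {e : ℕ → G.E} {d : ℕ → Bool}
    (h : IsWalk S n p e d) (hp : p n = p 0) (hs : ∏ i ∈ Finset.range n, s (e i) = -1) :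
    ∃ c : G.Cycle, c.inSub S ∧ ∏ i, s (c.edge i) = -1 ∧ G.connRel S (p 0) c.start := by
  induction n using Nat.strong_induction_on generalizing p e d with
  | _ n ih =>
  have hn : 0 < n := by
    rcases Nat.eq_zero_or_pos n with rfl | hn
    · simp at hs
    · exact hn
  by_cases hinj : ∀ i j, i < j → j < n → p i ≠ p j
  · have hedge := h.edge_inj hp hs hinj
    have hsrc : ∀ i : Fin n, G.esrc (e i) (d i) = p i := fun i => (h i i.2).2.1
    refine ⟨⟨n, hn, fun i => e i, fun i => d i, ?_, ?_, ?_⟩, fun i => (h i i.2).1, ?_, ?_⟩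
    · intro i j hij
      rcases lt_trichotomy i j with hlt | heq | hlt
      · exact absurd hij (hedge i j hlt j.2)
      · exact heq
      · exact absurd hij.symm (hedge j i hlt i.2)
    · intro i j hij
      simp only [hsrc] at hij
      rcases lt_trichotomy i j with hlt | heq | hlt
      · exact absurd hij (hinj i j hlt j.2)
      · exact heq
      · exact absurd hij.symm (hinj j i hlt i.2)
    · intro i
      rw [(h i i.2).2.2]
      have := hsrc ⟨((i : ℕ) + 1) % n, Nat.mod_lt _ hn⟩
      simp only at this ⊢
      rw [this]
      rcases Nat.lt_or_ge ((i : ℕ) + 1) n with hlt | hge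
      · rw [Nat.mod_eq_of_lt hlt]
      · have : (i : ℕ) + 1 = n := by omega
        rw [this, Nat.mod_self, hp]
    · rw [← hs, Finset.prod_range]
    · have hrefl : ∀ u, u = p 0 → G.connRel S (p 0) u := by
        rintro _ rfl
        exact .refl _
      exact hrefl _ (h 0 hn).2.1
  · push Not at hinj
    obtain ⟨i, j, hij, hj, hpij⟩ := hinj
    obtain ⟨m, rfl⟩ := Nat.exists_eq_add_of_lt hij
    obtain ⟨r, rfl⟩ := Nat.exists_eq_add_of_lt hj
    have hconn : G.connRel S (p 0) (p i) :=
      connRel_iff_sReach.2 ⟨_, IsWalk.sReach (s := s) (fun k hk => h k (by omega))⟩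
    rw [show i + m + 1 + r + 1 = i + (m + 1) + (r + 1) by ring, Finset.prod_range_add,
      Finset.prod_range_add] at hs
    rcases Int.units_eq_one_or (∏ k ∈ Finset.range (m + 1), s (e (i + k))) with h1 | h1
    · have hw : IsWalk S (i + (r + 1)) (fun k => if k < i then p k else p (k + (m + 1)))
          (fun k => if k < i then e k else e (k + (m + 1)))
          (fun k => if k < i then d k else d (k + (m + 1))) := by
        intro k hk
        by_cases hki : k < i
        · have := h k (by omega)
          by_cases hki' : k + 1 < i
          · simpa [hki, hki'] using this
          · have hk1 : k + 1 = i := by omega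
            simp only [hki, hki', if_true, if_false]
            rw [hk1] at this ⊢
            rw [← add_assoc, ← hpij]
            exact this
        · have := h (k + (m + 1)) (by omega)
          simp only [hki, if_false, show ¬ k + 1 < i by omega]
          rwa [show k + 1 + (m + 1) = k + (m + 1) + 1 by ring]
      have hclosed : (if i + (r + 1) < i then p (i + (r + 1)) else p (i + (r + 1) + (m + 1))) =
          if 0 < i then p 0 else p (0 + (m + 1)) := by
        have h2 : ¬ i + (r + 1) < i := by omega
        simp only [h2, if_false]
        rw [show i + (r + 1) + (m + 1) = i + m + 1 + r + 1 by ring, hp]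
        by_cases hi : 0 < i
        · simp [hi]
        · obtain rfl : i = 0 := by omega
          simpa using hpij
      have hsign : ∏ k ∈ Finset.range (i + (r + 1)),
          s (if k < i then e k else e (k + (m + 1))) = -1 := by
        rw [Finset.prod_range_add, ← hs, h1, mul_one]
        congr 1
        · exact Finset.prod_congr rfl fun k hk => by simp [Finset.mem_range.1 hk]
        · refine Finset.prod_congr rfl fun k _ => ?_
          simp only [show ¬ i + k < i by omega, if_false]
          congr 2
          ring
      obtain ⟨c, hc1, hc2, hc3⟩ := ih (i + (r + 1)) (by omega) hw hclosed hsign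
      refine ⟨c, hc1, hc2, ?_⟩
      by_cases hi : 0 < i
      · simpa [hi] using hc3
      · obtain rfl : i = 0 := by omega
        simp only [lt_irrefl, if_false, zero_add] at hc3 hpij
        rwa [hpij]
    · obtain ⟨c, hc1, hc2, hc3⟩ := ih (m + 1) (by omega)
        (p := fun k => p (i + k)) (e := fun k => e (i + k)) (d := fun k => d (i + k))
        (fun k hk => h (i + k) (by omega)) hpij.symm h1
      exact ⟨c, hc1, hc2, .trans _ _ _ hconn hc3⟩

theorem Cycle.sReach_start (c : G.Cycle) (hc : c.inSub S) :
    SReach S s c.start c.start (∏ i, s (c.edge i)) := by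
  have hmod : ∀ i, i % c.n < c.n := fun i => Nat.mod_lt _ c.npos
  have hw : IsWalk S c.n (fun i => G.esrc (c.edge ⟨i % c.n, hmod i⟩) (c.dir ⟨i % c.n, hmod i⟩))
      (fun i => c.edge ⟨i % c.n, hmod i⟩) (fun i => c.dir ⟨i % c.n, hmod i⟩) := by
    intro i hi
    refine ⟨hc _, rfl, ?_⟩
    rw [c.chain]
    simp only [Nat.mod_add_mod]
  have := hw.sReach (s := s)
  rw [Finset.prod_range] at this
  simpa [Nat.mod_eq_of_lt, Cycle.start] using this

theorem not_balanced_iff {v : G.V} : ¬ Balanced S s v ↔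
    ∃ c : G.Cycle, c.inSub S ∧ ∏ i, s (c.edge i) = -1 ∧ G.connRel S v c.start := by
  rw [Balanced, not_not]
  constructor
  · intro h
    have : Nonempty G.E := ⟨(G.noIsolated v).choose⟩
    obtain ⟨n, p, e, d, hw, h0, hn, hs⟩ := h.exists_isWalk
    have := hw.exists_cycle (hn.trans h0.symm) hs
    rwa [h0] at this
  · rintro ⟨c, hc, hs, hv⟩
    obtain ⟨x, hx⟩ := connRel_iff_sReach (s := s).1 hv
    have h := c.sReach_start (s := s) hc
    rw [hs] at h
    by_contra hv
    exact (hx.balanced_iff.1 hv) h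

theorem mem_incVerts_of_not_balanced {v : G.V} (h : ¬ Balanced S s v) : v ∈ G.incVerts S := by
  by_contra hv
  have := (SReach.eq_of_notMem_incVerts (not_not.1 h) hv).2
  revert this
  decide

theorem ncard_component_balanced :
    ((G.component S '' {v | Balanced S s v}).ncard : ℤ) +
      ((G.component S '' {v | ¬ Balanced S s v}).ncard : ℤ) + ((G.incVerts S).ncard : ℤ) =
    (Fintype.card G.V : ℤ) + (G.beta0 S : ℤ) := by
  have hfin : ∀ T : Set (Set G.V), T.Finite := fun T => T.toFinite
  have h1 : (G.component S '' {v | Balanced S s v}).ncard +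
      (G.component S '' {v | ¬ Balanced S s v}).ncard = (G.component S '' univ).ncard := by
    rw [← Set.ncard_union_eq _ (hfin _) (hfin _), ← Set.image_union]
    · congr
      ext v
      simp [em]
    · rw [Set.disjoint_left]
      rintro _ ⟨v, hv, rfl⟩ ⟨w, hw, hvw⟩
      obtain ⟨x, hx⟩ := connRel_iff_sReach (s := s).1 (component_eq_iff.1 hvw)
      exact hw (hx.balanced_iff.2 hv)
  have hout : ∀ {v w}, v ∉ G.incVerts S → G.connRel S v w → w = v := fun hv h =>
    (SReach.eq_of_notMem_incVerts (connRel_iff_sReach (s := s).1 h).choose_spec hv).1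
  have h2 : (G.incVerts S)ᶜ.ncard + G.beta0 S = (G.component S '' univ).ncard := by
    rw [← Set.InjOn.ncard_image (f := G.component S) (s := (G.incVerts S)ᶜ), beta0,
      ← Set.ncard_union_eq _ (hfin _) (hfin _), ← Set.image_union, Set.compl_union_self]
    · rw [Set.disjoint_left]
      rintro _ ⟨v, hv, rfl⟩ ⟨w, hw, hvw⟩
      rw [hout hv (component_eq_iff.1 hvw.symm)] at hw
      exact hv hw
    · intro v hv w _ hvw
      exact (hout hv (component_eq_iff.1 hvw)).symm
  have h3 := Set.ncard_add_ncard_compl (G.incVerts S)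
  rw [Nat.card_eq_fintype_card] at h3
  omega

/-- The space of vertex functions compatible with the signs of the edges in `S`. -/
def compatible (S : Set G.E) (s : G.E → ℤˣ) : Submodule ℂ (G.V → ℂ) where
  carrier := {g | ∀ e ∈ S, g (G.o e) = ((s e : ℤ) : ℂ) * g (G.t e)}
  add_mem' hf hg e he := by simp [hf e he, hg e he, mul_add]
  zero_mem' e _ := by simp
  smul_mem' c f hf e he := by simp [hf e he, mul_left_comm]

theorem unit_mul_self_cast (u : ℤˣ) : ((u : ℤ) : ℂ) * ((u : ℤ) : ℂ) = 1 := by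
  rcases Int.units_eq_one_or u with rfl | rfl <;> simp

theorem SReach.apply_eq {g : G.V → ℂ} (hg : g ∈ compatible S s) {v w : G.V} {x : ℤˣ}
    (h : SReach S s v w x) : g v = ((x : ℤ) : ℂ) * g w := by
  induction h with
  | refl v => simp
  | step e d he _ ih =>
    have h1 : g (G.o e) = ((s e : ℤ) : ℂ) * g (G.t e) := hg e he
    push_cast
    rw [mul_assoc, ← ih]
    cases d
    · simp only [esrc, edst, Bool.false_eq_true, if_false]
      rw [h1, ← mul_assoc, unit_mul_self_cast, one_mul]
    · simpa [esrc, edst] using h1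

theorem finrank_compatible :
    Module.finrank ℂ (compatible S s) = (G.component S '' {v | Balanced S s v}).ncard := by
  classical
  set B := G.component S '' {v | Balanced S s v}
  choose rep hrep hcomp using fun b : B => b.2
  let sgn : G.V → G.V → ℂ := fun v w =>
    if h : ∃ x, SReach S s v w x then ((h.choose : ℤ) : ℂ) else 0
  have hsgn : ∀ {v w x}, Balanced S s v → SReach S s v w x → sgn v w = ((x : ℤ) : ℂ) := by
    intro v w x hv h
    have hex : ∃ x, SReach S s v w x := ⟨x, h⟩
    simp only [sgn, hex, dif_pos, SReach.sign_unique hv hex.choose_spec h]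
  let ev : compatible S s →ₗ[ℂ] (B → ℂ) :=
    { toFun := fun g b => g.1 (rep b), map_add' := fun _ _ => rfl, map_smul' := fun _ _ => rfl }
  have hinj : Function.Injective ev := by
    rw [injective_iff_map_eq_zero]
    intro g hg
    ext v
    by_cases hv : Balanced S s v
    · let b : B := ⟨G.component S v, v, hv, rfl⟩
      obtain ⟨x, hx⟩ := connRel_iff_sReach (s := s).1 (component_eq_iff.1 (hcomp b).symm)
      have hb : g.1 (rep b) = 0 := congrFun hg b
      rw [hx.apply_eq g.2, hb]
      simp
    · have := (not_not.1 hv).apply_eq g.2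
      simp only [Units.val_neg, Units.val_one, Int.cast_neg, Int.cast_one, neg_mul, one_mul] at this
      simpa using self_eq_neg.1 this
  have hsurj : Function.Surjective ev := by
    intro h
    refine ⟨⟨fun w => if hw : Balanced S s w then
      sgn (rep ⟨G.component S w, w, hw, rfl⟩) w * h ⟨G.component S w, w, hw, rfl⟩ else 0, ?_⟩, ?_⟩
    · intro e he
      have hedge : SReach S s (G.o e) (G.t e) (s e) := SReach.edge true he
      have hc : G.component S (G.o e) = G.component S (G.t e) :=
        component_eq_iff.2 (connRel_iff_sReach.2 ⟨_, hedge⟩)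
      by_cases ho : Balanced S s (G.o e)
      · have ht := hedge.balanced_iff.1 ho
        simp only [ho, ht, dif_pos, hc]
        set b : B := ⟨G.component S (G.t e), _⟩
        obtain ⟨x, hx⟩ := connRel_iff_sReach (s := s).1 (component_eq_iff.1 (hcomp b))
        rw [hsgn (hrep b) hx, hsgn (hrep b) (hx.trans hedge.symm)]
        push_cast
        ring
      · have ht : ¬ Balanced S s (G.t e) := fun h => ho (hedge.balanced_iff.2 h)
        simp [ho, ht]
    · ext b
      have hb : Balanced S s (rep b) := hrep b
      have hb' : (⟨G.component S (rep b), rep b, hb, rfl⟩ : B) = b := Subtype.ext (hcomp b)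
      simp only [ev, LinearMap.coe_mk, AddHom.coe_mk, hb, dif_pos, hb']
      rw [hsgn hb (.refl _)]
      simp
  rw [(LinearEquiv.ofBijective ev ⟨hinj, hsurj⟩).finrank_eq, Module.finrank_pi,
    ← Nat.card_eq_fintype_card, Nat.card_coe_set_eq]

open scoped Classical in
/-- The incidence matrix of the subgraph `S` with edge signs `s`. -/
def incMat (S : Set G.E) (s : G.E → ℤˣ) : Matrix G.V S ℂ :=
  Matrix.of fun v e => (if G.t e = v then ((s e : ℤ) : ℂ) else 0) - if G.o e = v then 1 else 0

open scoped Classical in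
theorem finrank_ker_incMat :
    (Module.finrank ℂ (LinearMap.ker (incMat S s).mulVecLin) : ℤ) =
      G.beta1 S - ((G.component S '' {v | ¬ Balanced S s v}).ncard : ℤ) := by
  have h1 := LinearMap.finrank_range_add_finrank_ker (incMat S s).mulVecLin
  have h2 := LinearMap.finrank_range_add_finrank_ker (incMat S s).transpose.mulVecLin
  have h3 : LinearMap.ker (incMat S s).transpose.mulVecLin = compatible S s := by
    ext g
    rw [LinearMap.mem_ker, funext_iff, Subtype.forall]
    refine forall₂_congr fun e he => ?_
    rw [Matrix.mulVecLin_apply, Matrix.mulVec, dotProduct]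
    simp only [incMat, Matrix.transpose_apply, Matrix.of_apply, sub_mul, ite_mul, zero_mul, one_mul,
      Finset.sum_sub_distrib, Finset.sum_ite_eq, Finset.mem_univ, if_true, Pi.zero_apply,
      sub_eq_zero]
    exact eq_comm
  rw [h3, finrank_compatible] at h2
  have h4 := (incMat S s).rank_transpose
  rw [Matrix.rank, Matrix.rank] at h4
  rw [h4] at h2
  rw [Module.finrank_pi, ← Nat.card_eq_fintype_card, Nat.card_coe_set_eq] at h1
  rw [Module.finrank_pi] at h2
  have h5 := ncard_component_balanced (S := S) (s := s)
  rw [beta1]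
  omega

theorem Cycle.oddLength_iff {x : ℝ} (hx : x ≠ 0) {k : G.E → ℕ} (hk : ∀ e ∈ S, G.L e = k e * x)
    {c : G.Cycle} (hc : c.inSub S) :
    c.oddLength x ↔ ∏ i, (-1 : ℤˣ) ^ k (c.edge i) = -1 := by
  have hlen : c.length = (∑ i, k (c.edge i) : ℕ) * x := by
    push_cast
    rw [Cycle.length, Finset.sum_mul]
    exact Finset.sum_congr rfl fun i _ => hk _ (hc i)
  rw [Finset.prod_pow_eq_pow_sum, neg_one_pow_eq_neg_one_iff_odd (by decide), Cycle.oddLength, hlen]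
  constructor
  · rintro ⟨m, hm, h⟩
    rwa [Nat.cast_injective (mul_right_cancel₀ hx h)]
  · exact fun h => ⟨_, h, rfl⟩

theorem beta0odd_eq {x : ℝ} (hx : x ≠ 0) {k : G.E → ℕ} (hk : ∀ e ∈ S, G.L e = k e * x) :
    G.beta0odd S x = (G.component S '' {v | ¬ Balanced S (fun e => (-1) ^ k e) v}).ncard := by
  rw [beta0odd]
  congr 2
  ext v
  refine Iff.trans ?_ (and_iff_right_of_imp mem_incVerts_of_not_balanced)
  refine and_congr_right fun _ => ?_
  rw [mem_ofPred_eq, not_balanced_iff]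
  exact exists_congr fun c => and_congr_right fun hc =>
    and_congr_left' (c.oddLength_iff hx hk hc)

end SignedGraph

section Resonance

/-- Solutions of `f'' = -ω² f` vanishing at `0` are multiples of `sin (ω x)`. -/
theorem eq_sin_of_deriv_deriv {f : ℝ → ℂ} {ω : ℝ} (hω : ω ≠ 0) (hf : ContDiff ℝ 2 f)
    (hf' : ∀ x, deriv (deriv f) x = -((ω : ℂ) ^ 2) * f x) (h0 : f 0 = 0) (x : ℝ) :
    f x = deriv f 0 / ω * Real.sin (ω * x) := by
  have hd1 : ∀ x, HasDerivAt f (deriv f x) x := fun x =>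
    (hf.differentiable (by norm_num) x).hasDerivAt
  have hd2 : ∀ x, HasDerivAt (deriv f) (-((ω : ℂ) ^ 2) * f x) x := fun x => by
    rw [← hf']
    exact ((contDiff_succ_iff_deriv (n := 1)).1 hf |>.2.2.differentiable (by norm_num) x).hasDerivAt
  have hlin : ∀ x, HasDerivAt (fun x : ℝ => ω * x) ω x := fun x => by
    simpa using (hasDerivAt_id x).const_mul ω
  have hsin : ∀ x, HasDerivAt (fun x : ℝ => ((Real.sin (ω * x) : ℝ) : ℂ))
      ((Real.cos (ω * x) * ω : ℝ) : ℂ) x := fun x => (hlin x).sin.ofReal_comp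
  have hcos : ∀ x, HasDerivAt (fun x : ℝ => ((Real.cos (ω * x) : ℝ) : ℂ))
      ((-Real.sin (ω * x) * ω : ℝ) : ℂ) x := fun x => (hlin x).cos.ofReal_comp
  have hu : ∀ x, HasDerivAt (fun x : ℝ => deriv f x * Real.cos (ω * x) +
      ω * f x * Real.sin (ω * x)) 0 x := fun x => by
    refine (((hd2 x).mul (hcos x)).add (((hd1 x).const_mul (ω : ℂ)).mul (hsin x))).congr_deriv ?_
    push_cast
    ring
  have hw : ∀ x, HasDerivAt (fun x : ℝ => deriv f x * Real.sin (ω * x) -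
      ω * f x * Real.cos (ω * x)) 0 x := fun x => by
    refine (((hd2 x).mul (hsin x)).sub (((hd1 x).const_mul (ω : ℂ)).mul (hcos x))).congr_deriv ?_
    push_cast
    ring
  have hu' := is_const_of_deriv_eq_zero (fun x => (hu x).differentiableAt) (fun x => (hu x).deriv) x 0
  have hw' := is_const_of_deriv_eq_zero (fun x => (hw x).differentiableAt) (fun x => (hw x).deriv) x 0
  simp only [h0, mul_zero, Real.sin_zero, Real.cos_zero, Complex.ofReal_zero, Complex.ofReal_one,
    add_zero, mul_one, sub_zero] at hu' hw'
  have hsc : (Real.sin (ω * x) : ℂ) ^ 2 + (Real.cos (ω * x) : ℂ) ^ 2 = 1 := by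
    exact_mod_cast Real.sin_sq_add_cos_sq (ω * x)
  have hω' : (ω : ℂ) ≠ 0 := by exact_mod_cast hω
  field_simp
  linear_combination (Real.sin (ω * x) : ℂ) * hu' - (Real.cos (ω * x) : ℂ) * hw' -
    ω * f x * hsc

variable {G : MetricGraph}

theorem hasDerivAt_mul_sin (c : ℂ) (ω x : ℝ) :
    HasDerivAt (fun x : ℝ => c * (Real.sin (ω * x) : ℂ)) (c * (ω * Real.cos (ω * x))) x := by
  have hlin : HasDerivAt (fun x : ℝ => ω * x) ω x := by
    simpa using (hasDerivAt_id x).const_mul ω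
  refine (hlin.sin.ofReal_comp.const_mul c).congr_deriv ?_
  push_cast
  ring

theorem deriv_deriv_mul_sin (c : ℂ) (ω x : ℝ) :
    deriv (deriv fun x : ℝ => c * (Real.sin (ω * x) : ℂ)) x =
      -((ω : ℂ) ^ 2) * (c * Real.sin (ω * x)) := by
  have h : (deriv fun x : ℝ => c * (Real.sin (ω * x) : ℂ)) =
      fun x : ℝ => c * (ω * (Real.cos (ω * x) : ℂ)) :=
    funext fun x => (hasDerivAt_mul_sin c ω x).deriv
  have hlin : HasDerivAt (fun x : ℝ => ω * x) ω x := by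
    simpa using (hasDerivAt_id x).const_mul ω
  rw [h, ((hlin.cos.ofReal_comp.const_mul (ω : ℂ)).const_mul c).deriv]
  push_cast
  ring

open scoped Classical in
/-- The function equal to `a e * sin (ω x)` on the edges `e ∈ S` and zero on all others. -/
def sinMap (S : Set G.E) (ω : ℝ) : (S → ℂ) →ₗ[ℂ] (G.E → ℝ → ℂ) where
  toFun a e x := (if h : e ∈ S then a ⟨e, h⟩ else 0) * Real.sin (ω * x)
  map_add' a b := by
    ext e x
    by_cases h : e ∈ S <;> simp [h, add_mul]
  map_smul' c a := by
    ext e x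
    by_cases h : e ∈ S <;> simp [h, mul_assoc]

theorem sinMap_injective (S : Set G.E) {ω : ℝ} (hω : ω ≠ 0) :
    Function.Injective (sinMap S ω) := by
  intro a b hab
  ext ⟨e, he⟩
  have h := congrFun (congrFun hab e) (π / 2 / ω)
  have hx : ω * (π / 2 / ω) = π / 2 := mul_div_cancel₀ _ hω
  simpa [sinMap, he, hx, -Complex.ofReal_sin] using h

open scoped Classical in
theorem normDer_sinMap {S : Set G.E} {ω : ℝ} (hω : ω ≠ 0) {k : G.E → ℕ}
    (hk : ∀ e ∈ S, G.L e = k e * (π / ω)) (a : S → ℂ) (v : G.V) :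
    G.normDer (sinMap S ω a) v = ω * (incMat S (fun e => (-1) ^ k e)).mulVec a v := by
  have hsub : ∀ F : G.E → ℂ, (∀ e ∉ S, F e = 0) → ∑ e, F e = ∑ e : S, F e := fun F hF => by
    rw [Finset.sum_set_coe S]
    exact (Finset.sum_subset (Finset.subset_univ _) fun e _ he => hF e (by simpa using he)).symm
  have hderiv : ∀ e x, deriv (sinMap S ω a e) x =
      (if h : e ∈ S then a ⟨e, h⟩ else 0) * (ω * Real.cos (ω * x)) := fun e x =>
    (hasDerivAt_mul_sin _ ω x).deriv
  rw [normDer, Finset.sum_filter, Finset.sum_filter, ← Finset.sum_sub_distrib, hsub,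
    Matrix.mulVec, dotProduct, Finset.mul_sum]
  · refine Finset.sum_congr rfl fun ⟨e, he⟩ _ => ?_
    have hcos : Real.cos (ω * G.L e) = (-1) ^ k e := by
      rw [hk e he, ← Real.cos_nat_mul_pi]
      congr 1
      field_simp
    simp only [hderiv, he, dif_pos, hcos, incMat, Matrix.of_apply, mul_zero, Real.cos_zero]
    split_ifs <;> push_cast <;> ring
  · intro e he
    simp [hderiv, he]

theorem mem_lamEdges_iff {lam : ℝ} (hlam : 0 < lam) (e : G.E) :
    e ∈ G.lamEdges lam ↔ Real.sin (√lam * G.L e) = 0 := by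
  have hω : 0 < √lam := Real.sqrt_pos.2 hlam
  rw [Real.sin_eq_zero_iff]
  constructor
  · rintro ⟨k, -, hk⟩
    refine ⟨k, ?_⟩
    rw [hk]
    push_cast
    field_simp
  · rintro ⟨n, hn⟩
    have hpos : 0 < (n : ℝ) * π := hn ▸ mul_pos hω (G.L_pos e)
    have hn0 : 0 < n := by exact_mod_cast (pos_iff_pos_of_mul_pos hpos).2 Real.pi_pos
    lift n to ℕ using hn0.le
    refine ⟨n, by exact_mod_cast hn0, ?_⟩
    push_cast at hn
    field_simp
    linarith

open scoped Classical in
theorem resSet_eq {lam : ℝ} (hlam : 0 < lam) {k : G.E → ℕ}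
    (hk : ∀ e ∈ G.lamEdges lam, G.L e = k e * (π / √lam)) :
    G.resSet lam = ((LinearMap.ker (incMat (G.lamEdges lam) (fun e => (-1) ^ k e)).mulVecLin).map
      (sinMap (G.lamEdges lam) √lam) : Set (G.E → ℝ → ℂ)) := by
  have hω : √lam ≠ 0 := (Real.sqrt_pos.2 hlam).ne'
  have hω' : ((√lam : ℝ) : ℂ) ≠ 0 := by exact_mod_cast hω
  have hsq : ((√lam : ℝ) : ℂ) ^ 2 = lam := by exact_mod_cast Real.sq_sqrt hlam.le
  have hker : ∀ a, (∀ v, G.normDer (sinMap (G.lamEdges lam) √lam a) v = 0) ↔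
      a ∈ LinearMap.ker (incMat (G.lamEdges lam) (fun e => (-1) ^ k e)).mulVecLin := fun a => by
    rw [LinearMap.mem_ker, funext_iff]
    refine forall_congr' fun v => ?_
    rw [normDer_sinMap hω hk, mul_eq_zero, or_iff_right hω']
    rfl
  ext f
  constructor
  · rintro ⟨⟨⟨hf, hf', -⟩, hnd⟩, h0⟩
    have hsin : ∀ e x, f e x = deriv (f e) 0 / (√lam : ℝ) * Real.sin (√lam * x) := fun e x =>
      eq_sin_of_deriv_deriv hω (hf e) (by rw [hsq]; exact hf' e) (h0 e).1 x
    have hfa : sinMap (G.lamEdges lam) √lam (fun e => deriv (f e) 0 / (√lam : ℝ)) = f := by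
      ext e x
      rw [hsin e x]
      by_cases he : e ∈ G.lamEdges lam
      · simp [sinMap, he]
      · have h := hsin e (G.L e)
        rw [(h0 e).2, eq_comm, mul_eq_zero, Complex.ofReal_eq_zero,
          ← mem_lamEdges_iff hlam, or_iff_left he] at h
        simp [sinMap, he, h]
    exact ⟨_, (hker _).1 (hfa.symm ▸ hnd), hfa⟩
  · rintro ⟨a, ha, rfl⟩
    have h0 : ∀ e, sinMap (G.lamEdges lam) √lam a e 0 = 0 := fun e => by simp [sinMap]
    have hL : ∀ e, sinMap (G.lamEdges lam) √lam a e (G.L e) = 0 := fun e => by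
      by_cases he : e ∈ G.lamEdges lam
      · have := (mem_lamEdges_iff hlam e).1 he
        simp [sinMap, -Complex.ofReal_sin, this]
      · simp [sinMap, he]
    refine ⟨⟨⟨fun e => ?_, fun e x => ?_, fun _ _ _ => ?_, fun _ _ _ => ?_, fun _ _ _ => ?_⟩,
      (hker a).2 ha⟩, fun e => ⟨h0 e, hL e⟩⟩
    · exact contDiff_const.mul (Complex.ofRealCLM.contDiff.comp
        (Real.contDiff_sin.comp (contDiff_const.mul contDiff_id)))
    · rw [← hsq]
      exact deriv_deriv_mul_sin _ _ _
    · rw [h0, h0]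
    · rw [h0, hL]
    · rw [hL, hL]

end Resonance

end MetricGraph

/-- Theorem `thm:general`: for a finite metric graph `G` and `λ > 0`,
`dim R(G, λ) = β₁(G_λ) − β₀^odd(G_λ)`; in particular `λ` is a resonance of `G` if and
only if `β₁(G_λ) > β₀^odd(G_λ)`. -/
theorem statement_0 (G : MetricGraph) (lam : ℝ) (hlam : 0 < lam) :
    (G.dimRes lam : ℤ) =
      G.beta1 (G.lamEdges lam) - (G.beta0odd (G.lamEdges lam) (π / Real.sqrt lam) : ℤ) ∧
    (G.IsResonance lam ↔
      (G.beta0odd (G.lamEdges lam) (π / Real.sqrt lam) : ℤ) < G.beta1 (G.lamEdges lam)) := by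
  classical
  choose! k hk using fun (e : G.E) (he : e ∈ G.lamEdges lam) => he
  replace hk : ∀ e ∈ G.lamEdges lam, G.L e = k e * (π / √lam) := fun e he => (hk e he).2
  have hω : √lam ≠ 0 := (Real.sqrt_pos.2 hlam).ne'
  have hres := MetricGraph.resSet_eq hlam hk
  set N := LinearMap.ker
    (MetricGraph.incMat (G.lamEdges lam) (fun e => (-1) ^ k e)).mulVecLin
  have hinj := MetricGraph.sinMap_injective (G.lamEdges lam) hω
  have hdim : G.dimRes lam = Module.finrank ℂ
      (N.map (MetricGraph.sinMap (G.lamEdges lam) √lam)) := by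
    rw [MetricGraph.dimRes, hres, Submodule.span_eq]
  have hmain : (G.dimRes lam : ℤ) = G.beta1 (G.lamEdges lam) -
      (G.beta0odd (G.lamEdges lam) (π / √lam) : ℤ) := by
    rw [hdim, ← (Submodule.equivMapOfInjective _ hinj N).finrank_eq,
      MetricGraph.beta0odd_eq (div_ne_zero Real.pi_ne_zero hω) hk]
    exact MetricGraph.finrank_ker_incMat
  refine ⟨hmain, ?_⟩
  have hiff : G.IsResonance lam ↔ G.dimRes lam ≠ 0 := by
    rw [MetricGraph.IsResonance, hdim, hres, Ne, Ne, Submodule.finrank_eq_zero,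
      ← Submodule.bot_coe (R := ℂ), SetLike.coe_set_eq]
  rw [hiff]
  omega
end
end

section
/- Let G be a finite metric graph and let B = {v₁, …, v_m} be a nonempty set of vertices of G. Then the Titchmarsh–Weyl function μ ↦ M_B(μ) is meromorphic on ℂ, its poles are of order one and contained in the set of eigenvalues of −Δ_G, and for every λ ∈ ℝ the identity dim ker(−Δ_G − λ) = rank Res_λ M_B + dim R_B(G, λ) holds, where R_B(G, λ) := { f ∈ ker(−Δ_G − λ) : f(v) = 0 for all v ∈ B }. -/
open Real Set Filter Topology

noncomputable section

/-! ### The fundamental system of `-f'' = μ f` -/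

/-- The entire function `z ↦ ∑ (-z)ⁿ / (2n)!`, with `cosSq (w²) = cos w`. -/
def cosSq (z : ℂ) : ℂ := ∑' n : ℕ, (-z) ^ n / ((2 * n).factorial : ℂ)

/-- The entire function `z ↦ ∑ (-z)ⁿ / (2n+1)!`, with `w * sincSq (w²) = sin w`. -/
def sincSq (z : ℂ) : ℂ := ∑' n : ℕ, (-z) ^ n / ((2 * n + 1).factorial : ℂ)

lemma differentiable_tsum_neg_pow_div_factorial (a : ℕ → ℕ) (ha : ∀ n, n ≤ a n) :
    Differentiable ℂ fun z : ℂ => ∑' n : ℕ, (-z) ^ n / ((a n).factorial : ℂ) := by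
  intro z
  have hd : DifferentiableOn ℂ (fun z : ℂ => ∑' n : ℕ, (-z) ^ n / ((a n).factorial : ℂ))
      (Metric.ball 0 (‖z‖ + 1)) := by
    refine Complex.differentiableOn_tsum_of_summable_norm
      (Real.summable_pow_div_factorial (‖z‖ + 1)) (fun n => by fun_prop) Metric.isOpen_ball ?_
    intro n w hw
    rw [norm_div, norm_pow, norm_neg, Complex.norm_natCast]
    have hw' : ‖w‖ ≤ ‖z‖ + 1 := by simpa using (Metric.mem_ball.1 hw).le
    gcongr
    exact ha n
  exact hd.differentiableAt (Metric.isOpen_ball.mem_nhds (by simp))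

lemma differentiable_cosSq : Differentiable ℂ cosSq :=
  differentiable_tsum_neg_pow_div_factorial (fun n => 2 * n) fun n => by lia

lemma differentiable_sincSq : Differentiable ℂ sincSq :=
  differentiable_tsum_neg_pow_div_factorial (fun n => 2 * n + 1) fun n => by lia

lemma cosSq_sq (w : ℂ) : cosSq (w ^ 2) = Complex.cos w := by
  rw [Complex.cos_eq_tsum]
  refine tsum_congr fun n => ?_
  rw [neg_pow, ← pow_mul]

lemma mul_sincSq_sq (w : ℂ) : w * sincSq (w ^ 2) = Complex.sin w := by
  rw [Complex.sin_eq_tsum, sincSq, ← tsum_mul_left]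
  refine tsum_congr fun n => ?_
  rw [neg_pow, ← pow_mul]
  ring

lemma sincSq_zero : sincSq 0 = 1 := by
  rw [sincSq, tsum_eq_single 0 fun n hn => by simp [hn]]
  simp

lemma cosSq_zero : cosSq 0 = 1 := by simpa using cosSq_sq 0

lemma cosSq_conj (z : ℂ) : cosSq (star z) = star (cosSq z) := by
  simp [cosSq, Complex.conj_tsum]

lemma sincSq_conj (z : ℂ) : sincSq (star z) = star (sincSq z) := by
  simp [sincSq, Complex.conj_tsum]

/-- The solution of `-f'' = μ f` with `f 0 = 1` and `f' 0 = 0`. -/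
def cosSol (mu : ℂ) (x : ℝ) : ℂ := cosSq (mu * (x : ℂ) ^ 2)

/-- The solution of `-f'' = μ f` with `f 0 = 0` and `f' 0 = 1`. -/
def sinSol (mu : ℂ) (x : ℝ) : ℂ := x * sincSq (mu * (x : ℂ) ^ 2)

@[simp] lemma cosSol_zero (mu : ℂ) : cosSol mu 0 = 1 := by simp [cosSol, cosSq_zero]

@[simp] lemma sinSol_zero (mu : ℂ) : sinSol mu 0 = 0 := by simp [sinSol]

lemma cosSol_conj (mu : ℂ) (x : ℝ) : cosSol (star mu) x = star (cosSol mu x) := by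
  rw [cosSol, cosSol, ← cosSq_conj]
  simp

lemma sinSol_conj (mu : ℂ) (x : ℝ) : sinSol (star mu) x = star (sinSol mu x) := by
  have h := sincSq_conj (mu * (x : ℂ) ^ 2)
  simp only [sinSol, star_mul', ← h]
  simp

lemma continuous_cosSol : Continuous fun p : ℂ × ℝ => cosSol p.1 p.2 :=
  differentiable_cosSq.continuous.comp (by fun_prop)

lemma continuous_sinSol : Continuous fun p : ℂ × ℝ => sinSol p.1 p.2 :=
  (by fun_prop : Continuous fun p : ℂ × ℝ => (p.2 : ℂ)).mul
    (differentiable_sincSq.continuous.comp (by fun_prop))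

@[fun_prop]
lemma differentiable_cosSol (x : ℝ) : Differentiable ℂ fun mu => cosSol mu x :=
  differentiable_cosSq.comp (by fun_prop)

@[fun_prop]
lemma differentiable_sinSol (x : ℝ) : Differentiable ℂ fun mu => sinSol mu x :=
  (differentiable_sincSq.comp (by fun_prop : Differentiable ℂ fun mu : ℂ => mu * (x : ℂ) ^ 2)
    ).const_mul _

@[fun_prop]
lemma contDiff_cosSol (mu : ℂ) : ContDiff ℝ 2 (cosSol mu) := by
  have h : ContDiff ℝ 2 fun x : ℝ => mu * (x : ℂ) ^ 2 :=
    contDiff_const.mul (Complex.ofRealCLM.contDiff.pow 2)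
  exact (differentiable_cosSq.contDiff.restrict_scalars ℝ).comp h

@[fun_prop]
lemma contDiff_sinSol (mu : ℂ) : ContDiff ℝ 2 (sinSol mu) := by
  have h : ContDiff ℝ 2 fun x : ℝ => mu * (x : ℂ) ^ 2 :=
    contDiff_const.mul (Complex.ofRealCLM.contDiff.pow 2)
  exact Complex.ofRealCLM.contDiff.mul
    ((differentiable_sincSq.contDiff.restrict_scalars ℝ).comp h)

lemma cosSol_sq (k : ℂ) : cosSol (k ^ 2) = fun x : ℝ => Complex.cos (k * x) := by
  ext x
  rw [cosSol, ← mul_pow, cosSq_sq]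

lemma mul_sinSol_sq (k : ℂ) (x : ℝ) : k * sinSol (k ^ 2) x = Complex.sin (k * x) := by
  rw [sinSol, ← mul_pow, ← mul_assoc, mul_sincSq_sq]

lemma hasDerivAt_cosSol (mu : ℂ) (x : ℝ) :
    HasDerivAt (cosSol mu) (-mu * sinSol mu x) x := by
  obtain ⟨k, rfl⟩ := IsAlgClosed.exists_pow_nat_eq mu two_pos
  rw [cosSol_sq]
  have h := (((hasDerivAt_id (x : ℂ)).const_mul k).ccos).comp_ofReal
  refine h.congr_deriv ?_
  rw [id, ← mul_sinSol_sq]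
  ring

lemma hasDerivAt_sinSol (mu : ℂ) (x : ℝ) :
    HasDerivAt (sinSol mu) (cosSol mu x) x := by
  obtain ⟨k, rfl⟩ := IsAlgClosed.exists_pow_nat_eq mu two_pos
  have hx : HasDerivAt (fun x : ℝ => (x : ℂ)) 1 x := Complex.ofRealCLM.hasDerivAt
  rcases eq_or_ne k 0 with rfl | hk
  · have h1 : sinSol (0 ^ 2) = fun x : ℝ => (x : ℂ) := by
      ext y; simp [sinSol, sincSq_zero]
    rw [h1]
    simpa [cosSol, cosSq_zero] using hx
  · have h1 : sinSol (k ^ 2) = fun x : ℝ => k⁻¹ * Complex.sin (k * x) := by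
      ext y
      rw [← mul_sinSol_sq, inv_mul_cancel_left₀ hk]
    rw [h1, cosSol_sq]
    refine (((hasDerivAt_id (x : ℂ)).const_mul k).csin.const_mul k⁻¹).comp_ofReal.congr_deriv ?_
    rw [id]
    field_simp

lemma cosSol_sq_add (mu : ℂ) (x : ℝ) : cosSol mu x ^ 2 + mu * sinSol mu x ^ 2 = 1 := by
  obtain ⟨k, rfl⟩ := IsAlgClosed.exists_pow_nat_eq mu two_pos
  rw [← mul_pow, mul_sinSol_sq, cosSol_sq]
  exact Complex.cos_sq_add_sin_sq _

lemma eq_of_deriv_deriv_eq {mu : ℂ} {f : ℝ → ℂ} (hf : ContDiff ℝ 2 f)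
    (h : ∀ x, deriv (deriv f) x = -mu * f x) (x : ℝ) :
    f x = f 0 * cosSol mu x + deriv f 0 * sinSol mu x := by
  have d0 : ∀ y, HasDerivAt f (deriv f y) y := fun y =>
    (hf.differentiable (by norm_num) y).hasDerivAt
  have d1 : ∀ y, HasDerivAt (deriv f) (-mu * f y) y := fun y => by
    rw [← h y]
    exact ((hf.deriv' (n := 1)).differentiable (by norm_num) y).hasDerivAt
  have c1 : ∀ y, HasDerivAt (fun y => cosSol mu y * f y - sinSol mu y * deriv f y) 0 y :=
    fun y => by
      refine (((hasDerivAt_cosSol mu y).mul (d0 y)).sub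
        ((hasDerivAt_sinSol mu y).mul (d1 y))).congr_deriv ?_
      ring
  have c2 : ∀ y, HasDerivAt (fun y => cosSol mu y * deriv f y + mu * sinSol mu y * f y) 0 y :=
    fun y => by
      refine (((hasDerivAt_cosSol mu y).mul (d1 y)).add
        (((hasDerivAt_sinSol mu y).const_mul mu).mul (d0 y))).congr_deriv ?_
      ring
  have e1 := is_const_of_deriv_eq_zero (fun y => (c1 y).differentiableAt)
    (fun y => (c1 y).deriv) x 0
  have e2 := is_const_of_deriv_eq_zero (fun y => (c2 y).differentiableAt)
    (fun y => (c2 y).deriv) x 0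
  simp only [cosSol_zero, sinSol_zero] at e1 e2
  linear_combination (-f x) * cosSol_sq_add mu x + cosSol mu x * e1 + sinSol mu x * e2

namespace MetricGraph

variable (G : MetricGraph)

/-! ### Coordinates for edgewise solutions -/

/-- The edgewise solution of `-f'' = μ f` with initial values `X (inl (o e))` and initial
derivatives `X (inr e)`. -/
def sol (mu : ℂ) : (G.V ⊕ G.E → ℂ) →ₗ[ℂ] (G.E → ℝ → ℂ) where
  toFun X e x := X (.inl (G.o e)) * cosSol mu x + X (.inr e) * sinSol mu x
  map_add' X Y := by ext e x; simp only [Pi.add_apply]; ring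
  map_smul' a X := by
    ext e x; simp only [Pi.smul_apply, smul_eq_mul, RingHom.id_apply]; ring

/-- The edgewise derivative of `G.sol mu X`. -/
def solDer (mu : ℂ) (X : G.V ⊕ G.E → ℂ) (e : G.E) (x : ℝ) : ℂ :=
  -mu * X (.inl (G.o e)) * sinSol mu x + X (.inr e) * cosSol mu x

lemma sol_apply (mu : ℂ) (X : G.V ⊕ G.E → ℂ) (e : G.E) (x : ℝ) :
    G.sol mu X e x = X (.inl (G.o e)) * cosSol mu x + X (.inr e) * sinSol mu x := rfl

/-- The vertex conditions in coordinates: the normal derivatives of `G.sol mu X` at the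
vertices, and the deviation of its terminal values from the prescribed vertex values. -/
def vertexOp (mu : ℂ) : (G.V ⊕ G.E → ℂ) →ₗ[ℂ] (G.V ⊕ G.E → ℂ) where
  toFun X := Sum.elim
    (fun v => (∑ e ∈ Finset.univ.filter fun e => G.t e = v, G.solDer mu X e (G.L e)) -
      ∑ e ∈ Finset.univ.filter fun e => G.o e = v, X (.inr e))
    (fun e => G.sol mu X e (G.L e) - X (.inl (G.t e)))
  map_add' X Y := by
    ext (v | e)
    · simp only [solDer, Pi.add_apply, Sum.elim_inl, mul_add, add_mul, Finset.sum_add_distrib]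
      ring
    · simp only [map_add, Pi.add_apply, Sum.elim_inr]
      ring
  map_smul' a X := by
    ext (v | e)
    · simp only [solDer, Pi.smul_apply, smul_eq_mul, RingHom.id_apply, Sum.elim_inl, mul_sub,
        Finset.mul_sum]
      congr 1
      exact Finset.sum_congr rfl fun e _ => by ring
    · simp only [map_smul, Pi.smul_apply, smul_eq_mul, RingHom.id_apply, Sum.elim_inr]
      ring

lemma vertexOp_inl (mu : ℂ) (X : G.V ⊕ G.E → ℂ) (v : G.V) :
    G.vertexOp mu X (.inl v) =
      (∑ e ∈ Finset.univ.filter fun e => G.t e = v, G.solDer mu X e (G.L e)) -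
        ∑ e ∈ Finset.univ.filter fun e => G.o e = v, X (.inr e) := rfl

lemma vertexOp_inr (mu : ℂ) (X : G.V ⊕ G.E → ℂ) (e : G.E) :
    G.vertexOp mu X (.inr e) = G.sol mu X e (G.L e) - X (.inl (G.t e)) := rfl

lemma sol_zero (mu : ℂ) (X : G.V ⊕ G.E → ℂ) (e : G.E) : G.sol mu X e 0 = X (.inl (G.o e)) := by
  simp [sol_apply]

lemma solDer_zero (mu : ℂ) (X : G.V ⊕ G.E → ℂ) (e : G.E) : G.solDer mu X e 0 = X (.inr e) := by
  simp [solDer]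

variable {G}

lemma sol_length {mu : ℂ} {X : G.V ⊕ G.E → ℂ} {e : G.E} (h : G.vertexOp mu X (.inr e) = 0) :
    G.sol mu X e (G.L e) = X (.inl (G.t e)) := sub_eq_zero.1 h

variable (G)

lemma contDiff_sol (mu : ℂ) (X : G.V ⊕ G.E → ℂ) (e : G.E) : ContDiff ℝ 2 (G.sol mu X e) :=
  (contDiff_const.mul (contDiff_cosSol mu)).add (contDiff_const.mul (contDiff_sinSol mu))

lemma hasDerivAt_sol (mu : ℂ) (X : G.V ⊕ G.E → ℂ) (e : G.E) (x : ℝ) :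
    HasDerivAt (G.sol mu X e) (G.solDer mu X e x) x := by
  refine (((hasDerivAt_cosSol mu x).const_mul (X (.inl (G.o e)))).add
    ((hasDerivAt_sinSol mu x).const_mul (X (.inr e)))).congr_deriv ?_
  rw [solDer]
  ring

lemma hasDerivAt_solDer (mu : ℂ) (X : G.V ⊕ G.E → ℂ) (e : G.E) (x : ℝ) :
    HasDerivAt (G.solDer mu X e) (-mu * G.sol mu X e x) x := by
  refine (((hasDerivAt_sinSol mu x).const_mul (-mu * X (.inl (G.o e)))).add
    ((hasDerivAt_cosSol mu x).const_mul (X (.inr e)))).congr_deriv ?_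
  rw [sol_apply]
  ring

lemma deriv_sol (mu : ℂ) (X : G.V ⊕ G.E → ℂ) (e : G.E) :
    deriv (G.sol mu X e) = G.solDer mu X e :=
  funext fun x => (G.hasDerivAt_sol mu X e x).deriv

lemma normDer_sol (mu : ℂ) (X : G.V ⊕ G.E → ℂ) (v : G.V) :
    G.normDer (G.sol mu X) v = G.vertexOp mu X (.inl v) := by
  simp only [normDer, deriv_sol, vertexOp_inl, solDer_zero]

variable {G}

lemma isSol_sol {mu : ℂ} {X : G.V ⊕ G.E → ℂ} (h : ∀ e, G.vertexOp mu X (.inr e) = 0) :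
    G.IsSol mu (G.sol mu X) := by
  refine ⟨fun e => G.contDiff_sol mu X e, fun e x => ?_, ?_, ?_, ?_⟩
  · rw [deriv_sol, (G.hasDerivAt_solDer mu X e x).deriv]
  · intro e₁ e₂ he
    rw [sol_zero, sol_zero, he]
  · intro e₁ e₂ he
    rw [sol_zero, sol_length (h e₂), he]
  · intro e₁ e₂ he
    rw [sol_length (h e₁), sol_length (h e₂), he]

lemma vtxVal_o {f : G.E → ℝ → ℂ} (hf : G.ContVert f) (e : G.E) :
    G.vtxVal f (G.o e) = f e 0 := by
  have h : ∃ e', G.o e' = G.o e := ⟨e, rfl⟩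
  rw [vtxVal, dif_pos h]
  exact hf.1 _ _ h.choose_spec

lemma vtxVal_t {f : G.E → ℝ → ℂ} (hf : G.ContVert f) (e : G.E) :
    G.vtxVal f (G.t e) = f e (G.L e) := by
  by_cases h : ∃ e', G.o e' = G.t e
  · rw [vtxVal, dif_pos h]
    exact hf.2.1 _ _ h.choose_spec
  · rw [vtxVal, dif_neg h]
    exact hf.2.2 _ _ ((G.noIsolated (G.t e)).choose_spec.resolve_left fun h' => h ⟨_, h'⟩)

lemma vtxVal_sol {mu : ℂ} {X : G.V ⊕ G.E → ℂ} (h : ∀ e, G.vertexOp mu X (.inr e) = 0)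
    (v : G.V) : G.vtxVal (G.sol mu X) v = X (.inl v) := by
  obtain ⟨e, rfl | rfl⟩ := G.noIsolated v
  · rw [vtxVal_o (isSol_sol h).2.2, sol_zero]
  · rw [vtxVal_t (isSol_sol h).2.2, sol_length (h e)]

lemma IsSol.exists_eq_sol {mu : ℂ} {f : G.E → ℝ → ℂ} (hf : G.IsSol mu f) :
    ∃ X, f = G.sol mu X ∧ ∀ e, G.vertexOp mu X (.inr e) = 0 := by
  have hs : f = G.sol mu (Sum.elim (G.vtxVal f) fun e => deriv (f e) 0) := by
    ext e x
    rw [sol_apply, Sum.elim_inl, Sum.elim_inr, vtxVal_o hf.2.2]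
    exact eq_of_deriv_deriv_eq (hf.1 e) (hf.2.1 e) x
  refine ⟨_, hs, fun e => ?_⟩
  rw [vertexOp_inr, ← hs, Sum.elim_inl, vtxVal_t hf.2.2, sub_self]

lemma isTWsol_iff {mu : ℂ} {v₀ : G.V} {f : G.E → ℝ → ℂ} :
    G.IsTWsol mu v₀ f ↔
      ∃ X, f = G.sol mu X ∧ G.vertexOp mu X = Pi.single (.inl v₀) 1 := by
  constructor
  · rintro ⟨hf, h1, h0⟩
    obtain ⟨X, rfl, hX⟩ := hf.exists_eq_sol
    refine ⟨X, rfl, funext ?_⟩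
    rintro (v | e)
    · rw [← normDer_sol]
      rcases eq_or_ne v v₀ with rfl | hv
      · simpa using h1
      · simpa [hv] using h0 v hv
    · simpa using hX e
  · rintro ⟨X, rfl, hX⟩
    refine ⟨isSol_sol fun e => by simp [hX], ?_, fun v hv => ?_⟩
    · simp [normDer_sol, hX]
    · simp [normDer_sol, hX, hv]

lemma TW_apply {B : Finset G.V} {mu : ℂ} (hmu : Function.Injective (G.vertexOp mu)) (k l : B)
    {X : G.V ⊕ G.E → ℂ} (hX : G.vertexOp mu X = Pi.single (.inl (l : G.V)) 1) :
    G.TW B mu k l = X (.inl k) := by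
  have h : ∃ f, G.IsTWsol mu l f := ⟨_, isTWsol_iff.2 ⟨X, rfl, hX⟩⟩
  obtain ⟨Y, hY, hY'⟩ := isTWsol_iff.1 h.choose_spec
  obtain rfl : Y = X := hmu (hY'.trans hX.symm)
  rw [TW, Matrix.of_apply, dif_pos h, hY, vtxVal_sol fun e => by simp [hX]]

lemma mem_kerSet_iff {lam : ℝ} {f : G.E → ℝ → ℂ} :
    f ∈ G.kerSet lam ↔ ∃ X, G.vertexOp lam X = 0 ∧ f = G.sol lam X := by
  constructor
  · rintro ⟨hf, h0⟩
    obtain ⟨X, rfl, hX⟩ := hf.exists_eq_sol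
    refine ⟨X, funext ?_, rfl⟩
    rintro (v | e)
    · simpa [normDer_sol] using h0 v
    · exact hX e
  · rintro ⟨X, hX, rfl⟩
    exact ⟨isSol_sol fun e => by simp [hX], fun v => by simp [normDer_sol, hX]⟩

lemma mem_resSetB_iff {B : Set G.V} {lam : ℝ} {f : G.E → ℝ → ℂ} :
    f ∈ G.resSetB B lam ↔
      ∃ X, G.vertexOp lam X = 0 ∧ (∀ v ∈ B, X (.inl v) = 0) ∧ f = G.sol lam X := by
  constructor
  · rintro ⟨hf, h0⟩
    obtain ⟨X, hX, rfl⟩ := mem_kerSet_iff.1 hf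
    refine ⟨X, hX, fun v hv => ?_, rfl⟩
    obtain ⟨e, rfl | rfl⟩ := G.noIsolated v
    · rw [← sol_zero G lam X e]
      exact (h0 e).1 hv
    · rw [← sol_length (by simp [hX] : G.vertexOp lam X (.inr e) = 0)]
      exact (h0 e).2 hv
  · rintro ⟨X, hX, h0, rfl⟩
    refine ⟨mem_kerSet_iff.2 ⟨X, hX, rfl⟩, fun e => ⟨fun h => ?_, fun h => ?_⟩⟩
    · rw [sol_zero, h0 _ h]
    · rw [sol_length (by simp [hX]), h0 _ h]

lemma sol_injOn_ker (lam : ℂ) :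
    Function.Injective ((G.sol lam).comp (LinearMap.ker (G.vertexOp lam)).subtype) := by
  rw [← LinearMap.ker_eq_bot, LinearMap.ker_eq_bot']
  rintro ⟨X, hX⟩ h
  have hX : G.vertexOp lam X = 0 := hX
  have h : G.sol lam X = 0 := h
  have hc : ∀ e, G.vertexOp lam X (.inr e) = 0 := by simp [hX]
  ext (v | e)
  · change X (.inl v) = 0
    obtain ⟨e, rfl | rfl⟩ := G.noIsolated v
    · rw [← sol_zero G lam X e, h]
      rfl
    · rw [← sol_length (hc e), h]
      rfl
  · change X (.inr e) = 0
    rw [← solDer_zero G lam X e, ← deriv_sol, h]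
    exact deriv_const 0 0

variable (G) in
/-- Restriction of the elements of `ker (-Δ_G - λ)`, in coordinates, to the vertices in `B`. -/
def kerRestrict (B : Finset G.V) (lam : ℂ) :
    LinearMap.ker (G.vertexOp lam) →ₗ[ℂ] (B → ℂ) :=
  LinearMap.pi fun k => (LinearMap.proj (.inl (k : G.V))).comp
    (LinearMap.ker (G.vertexOp lam)).subtype

lemma dimKer_eq (lam : ℝ) :
    G.dimKer lam = Module.finrank ℂ (LinearMap.ker (G.vertexOp lam)) := by
  have h : G.kerSet lam = (LinearMap.range
      ((G.sol lam).comp (LinearMap.ker (G.vertexOp lam)).subtype) : Set (G.E → ℝ → ℂ)) := by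
    ext f
    rw [mem_kerSet_iff]
    constructor
    · rintro ⟨X, hX, rfl⟩
      exact ⟨⟨X, hX⟩, rfl⟩
    · rintro ⟨⟨X, hX⟩, rfl⟩
      exact ⟨X, hX, rfl⟩
  rw [dimKer, h, Submodule.span_eq, LinearMap.finrank_range_of_inj (sol_injOn_ker _)]

lemma dimResB_eq (B : Finset G.V) (lam : ℝ) :
    G.dimResB (↑B) lam = Module.finrank ℂ (LinearMap.ker (G.kerRestrict B lam)) := by
  have h : G.resSetB (↑B) lam = (Submodule.map
      ((G.sol lam).comp (LinearMap.ker (G.vertexOp lam)).subtype)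
      (LinearMap.ker (G.kerRestrict B lam)) : Set (G.E → ℝ → ℂ)) := by
    ext f
    rw [mem_resSetB_iff]
    constructor
    · rintro ⟨X, hX, h0, rfl⟩
      exact ⟨⟨X, hX⟩, funext fun v => h0 v v.2, rfl⟩
    · rintro ⟨⟨X, hX⟩, h0, rfl⟩
      exact ⟨X, hX, fun v hv => congrFun h0 ⟨v, hv⟩, rfl⟩
  rw [dimResB, h, Submodule.span_eq]
  exact (Submodule.equivMapOfInjective _ (sol_injOn_ker _) _).finrank_eq.symm

lemma isEigenvalue_iff {lam : ℝ} :
    G.IsEigenvalue lam ↔ ¬ Function.Injective (G.vertexOp lam) := by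
  rw [IsEigenvalue, not_iff_not, ← LinearMap.ker_eq_bot, LinearMap.ker_eq_bot']
  constructor
  · intro h X hX
    have h0 : G.sol lam X ∈ G.kerSet lam := mem_kerSet_iff.2 ⟨X, hX, rfl⟩
    rw [h] at h0
    exact congrArg Subtype.val (sol_injOn_ker (lam : ℂ) (a₁ := ⟨X, hX⟩) (a₂ := 0) (by simpa using h0))
  · intro h
    ext f
    rw [mem_kerSet_iff, Set.mem_singleton_iff]
    constructor
    · rintro ⟨X, hX, rfl⟩
      rw [h X hX, map_zero]
    · rintro rfl
      exact ⟨0, by simp, by simp⟩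

/-! ### Green's identity -/

lemma sol_star (mu : ℂ) (X : G.V ⊕ G.E → ℂ) (e : G.E) (x : ℝ) :
    G.sol (star mu) (star X) e x = star (G.sol mu X e x) := by
  simp only [sol_apply, cosSol_conj, sinSol_conj, Pi.star_apply, star_add, star_mul']

lemma solDer_star (mu : ℂ) (X : G.V ⊕ G.E → ℂ) (e : G.E) (x : ℝ) :
    G.solDer (star mu) (star X) e x = star (G.solDer mu X e x) := by
  simp only [solDer, cosSol_conj, sinSol_conj, Pi.star_apply, star_add, star_mul', star_neg]

lemma vertexOp_star (mu : ℂ) (X : G.V ⊕ G.E → ℂ) :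
    G.vertexOp (star mu) (star X) = star (G.vertexOp mu X) := by
  ext (v | e)
  · simp only [vertexOp_inl, solDer_star, Pi.star_apply, star_sub, star_sum]
  · simp only [vertexOp_inr, sol_star, Pi.star_apply, star_sub]

variable (G) in
/-- The bilinear `L²` pairing of `G.sol mu X` and `G.sol lam Y`. -/
def pairing (mu lam : ℂ) (X Y : G.V ⊕ G.E → ℂ) : ℂ :=
  ∑ e, ∫ x in (0 : ℝ)..G.L e, G.sol mu X e x * G.sol lam Y e x

lemma sum_fiber_mul (g : G.E → G.V) (a : G.E → ℂ) (y : G.V → ℂ) :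
    ∑ v, (∑ e ∈ Finset.univ.filter fun e => g e = v, a e) * y v = ∑ e, a e * y (g e) := by
  simp only [Finset.sum_filter, Finset.sum_mul]
  rw [Finset.sum_comm]
  simp

lemma sum_vertexOp_mul (mu : ℂ) (X : G.V ⊕ G.E → ℂ) (y : G.V → ℂ) :
    ∑ v, G.vertexOp mu X (.inl v) * y v =
      ∑ e, (G.solDer mu X e (G.L e) * y (G.t e) - X (.inr e) * y (G.o e)) := by
  simp only [vertexOp_inl, sub_mul, Finset.sum_sub_distrib, sum_fiber_mul]

theorem sub_mul_pairing {mu lam : ℂ} {X Y : G.V ⊕ G.E → ℂ}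
    (hX : ∀ e, G.vertexOp mu X (.inr e) = 0) (hY : ∀ e, G.vertexOp lam Y (.inr e) = 0) :
    (lam - mu) * G.pairing mu lam X Y =
      ∑ v, G.vertexOp mu X (.inl v) * Y (.inl v) -
        ∑ v, G.vertexOp lam Y (.inl v) * X (.inl v) := by
  rw [sum_vertexOp_mul mu X fun v => Y (.inl v), sum_vertexOp_mul lam Y fun v => X (.inl v),
    pairing, Finset.mul_sum, ← Finset.sum_sub_distrib]
  refine Finset.sum_congr rfl fun e _ => ?_
  have hd : ∀ x ∈ Set.uIcc 0 (G.L e), HasDerivAt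
      (fun x => G.solDer mu X e x * G.sol lam Y e x - G.sol mu X e x * G.solDer lam Y e x)
      ((lam - mu) * (G.sol mu X e x * G.sol lam Y e x)) x := fun x _ => by
    refine (((G.hasDerivAt_solDer mu X e x).mul (G.hasDerivAt_sol lam Y e x)).sub
      ((G.hasDerivAt_sol mu X e x).mul (G.hasDerivAt_solDer lam Y e x))).congr_deriv ?_
    ring
  rw [← intervalIntegral.integral_const_mul, intervalIntegral.integral_eq_sub_of_hasDerivAt hd
    (((G.contDiff_sol mu X e).continuous.mul
      (G.contDiff_sol lam Y e).continuous).const_mul _ |>.intervalIntegrable _ _)]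
  simp only [sol_length (hX e), sol_length (hY e), sol_zero, solDer_zero]
  ring

lemma eq_zero_of_pairing_star_eq_zero {mu : ℂ} {X : G.V ⊕ G.E → ℂ}
    (hX : ∀ e, G.vertexOp mu X (.inr e) = 0)
    (h : G.pairing mu (star mu) X (star X) = 0) : X = 0 := by
  have hc : ∀ e, Continuous (G.sol mu X e) := fun e => (G.contDiff_sol mu X e).continuous
  have h1 : ∑ e, ∫ x in (0 : ℝ)..G.L e, Complex.normSq (G.sol mu X e x) = 0 := by
    rw [← Complex.ofReal_inj, Complex.ofReal_sum, Complex.ofReal_zero, ← h, pairing]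
    refine Finset.sum_congr rfl fun e _ => ?_
    rw [← intervalIntegral.integral_ofReal]
    refine intervalIntegral.integral_congr fun x _ => ?_
    exact (Complex.mul_conj _).symm.trans (congrArg _ (sol_star mu X e x).symm)
  have h2 : ∀ e, ∫ x in (0 : ℝ)..G.L e, Complex.normSq (G.sol mu X e x) = 0 := fun e =>
    (Finset.sum_eq_zero_iff_of_nonneg fun e _ => intervalIntegral.integral_nonneg
      (G.L_pos e).le fun x _ => Complex.normSq_nonneg _).1 h1 e (Finset.mem_univ e)
  have h3 : ∀ e, ∀ x ∈ Set.Icc 0 (G.L e), G.sol mu X e x = 0 := fun e x hx => by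
    by_contra hne
    exact (intervalIntegral.integral_pos (G.L_pos e)
      (Complex.continuous_normSq.comp (hc e)).continuousOn
      (fun y _ => Complex.normSq_nonneg _) ⟨x, hx, Complex.normSq_pos.2 hne⟩).ne' (h2 e)
  have ho : ∀ e, X (.inl (G.o e)) = 0 := fun e => by
    rw [← sol_zero G mu X e]
    exact h3 e 0 ⟨le_rfl, (G.L_pos e).le⟩
  ext (v | e)
  · obtain ⟨e, rfl | rfl⟩ := G.noIsolated v
    · exact ho e
    · rw [← sol_length (hX e)]
      exact h3 e _ ⟨(G.L_pos e).le, le_rfl⟩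
  · have hL := G.L_pos e
    have h4 := h3 e (G.L e / 2) ⟨by linarith, by linarith⟩
    have h5 : G.solDer mu X e (G.L e / 2) = 0 := by
      refine (G.hasDerivAt_sol mu X e _).unique ((hasDerivAt_const _ (0 : ℂ)).congr_of_eventuallyEq
        ?_)
      filter_upwards [Icc_mem_nhds (by linarith : 0 < G.L e / 2) (by linarith : G.L e / 2 < G.L e)]
        with x hx using h3 e x hx
    rw [sol_apply, ho] at h4
    rw [solDer, ho] at h5
    simp only [Pi.zero_apply]
    linear_combination (-X (.inr e)) * cosSol_sq_add mu (G.L e / 2) +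
      cosSol mu (G.L e / 2) * h5 + mu * sinSol mu (G.L e / 2) * h4

lemma vertexOp_injective_of_im_ne_zero {mu : ℂ} (hmu : mu.im ≠ 0) :
    Function.Injective (G.vertexOp mu) := by
  rw [← LinearMap.ker_eq_bot, LinearMap.ker_eq_bot']
  intro X hX
  have hX' : G.vertexOp (star mu) (star X) = 0 := by rw [vertexOp_star, hX, star_zero]
  have h := sub_mul_pairing (X := X) (Y := star X) (mu := mu) (lam := star mu)
    (fun e => congrFun hX _) (fun e => congrFun hX' _)
  refine eq_zero_of_pairing_star_eq_zero (fun e => congrFun hX _) ?_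
  simp only [hX, hX', Pi.zero_apply, zero_mul, Finset.sum_const_zero, sub_zero] at h
  refine (mul_eq_zero.1 h).resolve_left fun h' => hmu ?_
  exact Complex.conj_eq_iff_im.1 (sub_eq_zero.1 h')

lemma continuous_pairing (lam : ℂ) (Y : G.V ⊕ G.E → ℂ) :
    Continuous fun p : ℂ × (G.V ⊕ G.E → ℂ) => G.pairing p.1 lam p.2 Y := by
  refine continuous_finsetSum _ fun e _ => ?_
  refine intervalIntegral.continuous_parametric_intervalIntegral_of_continuous' ?_ _ _
  have hq : Continuous fun q : (ℂ × (G.V ⊕ G.E → ℂ)) × ℝ => (q.1.1, q.2) := by fun_prop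
  have hX : ∀ i, Continuous fun q : (ℂ × (G.V ⊕ G.E → ℂ)) × ℝ => q.1.2 i := fun i => by fun_prop
  exact (((hX _).mul (continuous_cosSol.comp hq)).add
    ((hX _).mul (continuous_sinSol.comp hq))).mul
      ((G.contDiff_sol lam Y e).continuous.comp continuous_snd)

end MetricGraph

lemma differentiable_det {n : Type*} [Fintype n] [DecidableEq n] {M : ℂ → Matrix n n ℂ}
    (hM : ∀ i j, Differentiable ℂ fun z => M z i j) : Differentiable ℂ fun z => (M z).det := by
  simp only [Matrix.det_apply']
  exact Differentiable.fun_sum fun σ _ =>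
    (Differentiable.fun_finsetProd fun i _ => hM _ _).const_mul _

lemma AnalyticAt.exists_eq_sub_smul {E : Type*} [NormedAddCommGroup E] [NormedSpace ℂ E]
    {H : ℂ → E} {z₀ : ℂ} (hH : AnalyticAt ℂ H z₀) (h0 : H z₀ = 0) :
    ∃ H₁ : ℂ → E, AnalyticAt ℂ H₁ z₀ ∧ ∀ z, H z = (z - z₀) • H₁ z := by
  obtain ⟨p, hp⟩ := hH
  exact ⟨dslope H z₀, ⟨_, hp.has_fpower_series_dslope_fslope⟩,
    fun z => by rw [sub_smul_dslope, h0, sub_zero]⟩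

namespace MetricGraph

variable {G : MetricGraph}

/-! ### Analytic dependence on the spectral parameter -/

lemma differentiable_vertexOp (X : G.V ⊕ G.E → ℂ) (i : G.V ⊕ G.E) :
    Differentiable ℂ fun mu => G.vertexOp mu X i := by
  rcases i with v | e
  · simp only [vertexOp_inl, solDer]
    fun_prop
  · simp only [vertexOp_inr, sol_apply]
    fun_prop

lemma continuous_vertexOp :
    Continuous fun p : ℂ × (G.V ⊕ G.E → ℂ) => G.vertexOp p.1 p.2 := by
  have hc : ∀ e, Continuous fun p : ℂ × (G.V ⊕ G.E → ℂ) => cosSol p.1 (G.L e) := fun e =>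
    (differentiable_cosSol (G.L e)).continuous.comp continuous_fst
  have hs : ∀ e, Continuous fun p : ℂ × (G.V ⊕ G.E → ℂ) => sinSol p.1 (G.L e) := fun e =>
    (differentiable_sinSol (G.L e)).continuous.comp continuous_fst
  refine continuous_pi ?_
  rintro (v | e)
  · simp only [vertexOp_inl, solDer]
    fun_prop
  · simp only [vertexOp_inr, sol_apply]
    fun_prop

variable (G) in
/-- The matrix of `G.vertexOp mu`. -/
def vertexMat (mu : ℂ) : Matrix (G.V ⊕ G.E) (G.V ⊕ G.E) ℂ :=
  LinearMap.toMatrix' (G.vertexOp mu)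

lemma vertexMat_mulVec (mu : ℂ) (X : G.V ⊕ G.E → ℂ) :
    (G.vertexMat mu).mulVec X = G.vertexOp mu X :=
  LinearMap.toMatrix'_mulVec _ _

lemma differentiable_vertexMat (i j : G.V ⊕ G.E) :
    Differentiable ℂ fun mu => G.vertexMat mu i j := by
  simp only [vertexMat, LinearMap.toMatrix'_apply]
  exact differentiable_vertexOp _ i

lemma differentiable_det_vertexMat : Differentiable ℂ fun mu => (G.vertexMat mu).det :=
  differentiable_det differentiable_vertexMat

lemma differentiable_cramer_vertexMat (b : G.V ⊕ G.E → ℂ) :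
    Differentiable ℂ fun mu => (G.vertexMat mu).cramer b := by
  refine differentiable_pi.2 fun i => ?_
  simp only [Matrix.cramer_apply]
  refine differentiable_det fun j k => ?_
  simp only [Matrix.updateCol_apply]
  split_ifs
  · fun_prop
  · exact differentiable_vertexMat j k

lemma vertexOp_injective_iff {mu : ℂ} :
    Function.Injective (G.vertexOp mu) ↔ (G.vertexMat mu).det ≠ 0 := by
  rw [← isUnit_iff_ne_zero, ← Matrix.isUnit_iff_isUnit_det, ← Matrix.mulVec_injective_iff_isUnit]
  exact iff_of_eq (congrArg _ (funext fun X => (vertexMat_mulVec mu X).symm))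

lemma eventually_vertexOp_injective (lam : ℂ) :
    ∀ᶠ mu in 𝓝[≠] lam, Function.Injective (G.vertexOp mu) := by
  simp only [vertexOp_injective_iff]
  have ha : AnalyticOnNhd ℂ (fun mu => (G.vertexMat mu).det) Set.univ :=
    fun z _ => differentiable_det_vertexMat.analyticAt z
  refine (ha lam (Set.mem_univ _)).eventually_eq_zero_or_eventually_ne_zero.resolve_left fun h => ?_
  have h0 := ha.eqOn_zero_of_preconnected_of_eventuallyEq_zero isPreconnected_univ
    (Set.mem_univ lam) h (Set.mem_univ Complex.I)
  exact vertexOp_injective_iff.1 (vertexOp_injective_of_im_ne_zero (by simp)) h0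

lemma exists_analyticAt_preimage (lam : ℂ) (b : G.V ⊕ G.E → ℂ) :
    ∃ (n : ℕ) (H : ℂ → (G.V ⊕ G.E → ℂ)), AnalyticAt ℂ H lam ∧
      (∀ᶠ mu in 𝓝[≠] lam, G.vertexOp mu (H mu) = (mu - lam) ^ n • b) ∧
      (Function.Injective (G.vertexOp lam) → n = 0) := by
  have hd := (differentiable_det_vertexMat (G := G)).analyticAt lam
  obtain ⟨n, g, hg, hg0, hgn⟩ := hd.exists_eventuallyEq_pow_smul_nonzero_iff.2 fun h => by
    obtain ⟨z, hz, hz'⟩ := ((h.filter_mono nhdsWithin_le_nhds).and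
      (eventually_vertexOp_injective (G := G) lam)).exists
    exact vertexOp_injective_iff.1 hz' hz
  refine ⟨n, fun mu => (g mu)⁻¹ • (G.vertexMat mu).cramer b, ?_, ?_, fun h => ?_⟩
  · exact (hg.inv hg0).smul ((differentiable_cramer_vertexMat b).analyticAt lam)
  · filter_upwards [(hgn.and (hg.continuousAt.eventually_ne hg0)).filter_mono
      nhdsWithin_le_nhds] with mu ⟨h1, h2⟩
    rw [map_smul, ← vertexMat_mulVec, Matrix.mulVec_cramer, h1, smul_smul, smul_eq_mul,
      mul_left_comm, inv_mul_cancel₀ h2, mul_one]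
  · by_contra hn
    apply vertexOp_injective_iff.1 h
    rw [hgn.self_of_nhds, sub_self, zero_pow hn, zero_smul]

lemma vertexOp_apply_of_tendsto {lam : ℂ} {H : ℂ → (G.V ⊕ G.E → ℂ)} {b : G.V ⊕ G.E → ℂ} {n : ℕ}
    (hH : ContinuousAt H lam)
    (h : ∀ᶠ mu in 𝓝[≠] lam, G.vertexOp mu (H mu) = (mu - lam) ^ (n + 1) • b) :
    G.vertexOp lam (H lam) = 0 := by
  have h1 : Tendsto (fun mu => G.vertexOp mu (H mu)) (𝓝[≠] lam) (𝓝 (G.vertexOp lam (H lam))) :=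
    ((continuous_vertexOp.continuousAt (x := (lam, H lam))).comp
      (f := fun mu => (mu, H mu)) (continuousAt_id.prodMk hH)).tendsto.mono_left nhdsWithin_le_nhds
  have h2 : Tendsto (fun mu => (mu - lam) ^ (n + 1) • b) (𝓝[≠] lam) (𝓝 0) := by
    have hc : Continuous fun mu : ℂ => (mu - lam) ^ (n + 1) • b := by fun_prop
    exact (hc.tendsto' lam 0 (by simp)).mono_left nhdsWithin_le_nhds
  exact tendsto_nhds_unique h1 (h2.congr' (h.mono fun _ h => h.symm))

lemma pairing_apply_of_tendsto {lam : ℂ} {H : ℂ → (G.V ⊕ G.E → ℂ)} {v₀ : G.V} {n : ℕ}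
    (hH : ContinuousAt H lam)
    (h : ∀ᶠ mu in 𝓝[≠] lam,
      G.vertexOp mu (H mu) = (mu - lam) ^ (n + 1) • Pi.single (.inl v₀) 1)
    {Y : G.V ⊕ G.E → ℂ} (hY : G.vertexOp lam Y = 0) :
    G.pairing lam lam (H lam) Y = -(0 ^ n * Y (.inl v₀)) := by
  have h1 : Tendsto (fun mu => G.pairing mu lam (H mu) Y) (𝓝[≠] lam)
      (𝓝 (G.pairing lam lam (H lam) Y)) :=
    (((continuous_pairing lam Y).continuousAt (x := (lam, H lam))).comp
      (f := fun mu => (mu, H mu)) (continuousAt_id.prodMk hH)).tendsto.mono_left nhdsWithin_le_nhds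
  have h2 : Tendsto (fun mu => -((mu - lam) ^ n * Y (.inl v₀))) (𝓝[≠] lam)
      (𝓝 (-(0 ^ n * Y (.inl v₀)))) := by
    have hc : Continuous fun mu : ℂ => -((mu - lam) ^ n * Y (.inl v₀)) := by fun_prop
    exact (hc.tendsto' lam _ (by simp)).mono_left nhdsWithin_le_nhds
  refine tendsto_nhds_unique h1 (h2.congr' ?_)
  filter_upwards [h, self_mem_nhdsWithin] with mu hmu hne
  have hne : mu - lam ≠ 0 := sub_ne_zero.2 hne
  have hg := sub_mul_pairing (X := H mu) (Y := Y) (mu := mu) (lam := lam) (by simp [hmu])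
    (fun e => congrFun hY _)
  have hs : ∑ v, G.vertexOp mu (H mu) (.inl v) * Y (.inl v) =
      (mu - lam) ^ (n + 1) * Y (.inl v₀) := by
    rw [Finset.sum_eq_single v₀ (fun v _ hv => by simp [hmu, hv]) (by simp)]
    simp [hmu]
  rw [hs, hY] at hg
  simp only [Pi.zero_apply, zero_mul, Finset.sum_const_zero, sub_zero] at hg
  apply mul_left_cancel₀ hne
  linear_combination hg

lemma vertexOp_star_eq_zero {lam : ℝ} {Y : G.V ⊕ G.E → ℂ} (hY : G.vertexOp lam Y = 0) :
    G.vertexOp lam (star Y) = 0 := by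
  have h := vertexOp_star (lam : ℂ) Y
  rwa [hY, star_zero, Complex.star_def, Complex.conj_ofReal] at h

lemma eq_zero_of_pairing_self_eq_zero {lam : ℝ} {Y : G.V ⊕ G.E → ℂ}
    (hY : G.vertexOp lam Y = 0) (h : G.pairing lam lam Y (star Y) = 0) : Y = 0 :=
  eq_zero_of_pairing_star_eq_zero (mu := lam) (fun e => congrFun hY _) (by
    rwa [Complex.star_def, Complex.conj_ofReal])

theorem exists_analyticAt_simple_pole (lam : ℝ) (v₀ : G.V) :
    ∃ H : ℂ → (G.V ⊕ G.E → ℂ), AnalyticAt ℂ H lam ∧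
      ∀ᶠ mu in 𝓝[≠] (lam : ℂ), G.vertexOp mu (H mu) = (mu - lam) ^ 1 • Pi.single (.inl v₀) 1 := by
  have key : ∀ n : ℕ, (∃ H : ℂ → (G.V ⊕ G.E → ℂ), AnalyticAt ℂ H lam ∧
      ∀ᶠ mu in 𝓝[≠] (lam : ℂ),
        G.vertexOp mu (H mu) = (mu - lam) ^ (n + 1) • Pi.single (.inl v₀) 1) →
      ∃ H : ℂ → (G.V ⊕ G.E → ℂ), AnalyticAt ℂ H lam ∧ ∀ᶠ mu in 𝓝[≠] (lam : ℂ),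
        G.vertexOp mu (H mu) = (mu - lam) ^ 1 • Pi.single (.inl v₀) 1 := by
    intro n
    induction n with
    | zero => exact id
    | succ n ih =>
      rintro ⟨H, hH, h⟩
      have hK := vertexOp_apply_of_tendsto hH.continuousAt h
      have h0 : H lam = 0 := eq_zero_of_pairing_self_eq_zero hK <| by
        rw [pairing_apply_of_tendsto hH.continuousAt h (vertexOp_star_eq_zero hK)]
        simp
      obtain ⟨H₁, hH₁, hHH₁⟩ := hH.exists_eq_sub_smul h0
      refine ih ⟨H₁, hH₁, ?_⟩
      filter_upwards [h, self_mem_nhdsWithin] with mu hmu hne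
      have hne : mu - lam ≠ 0 := sub_ne_zero.2 hne
      rw [hHH₁, map_smul, pow_succ', mul_smul] at hmu
      exact smul_right_injective _ hne hmu
  obtain ⟨n, H, hH, h, -⟩ := exists_analyticAt_preimage (G := G) lam (Pi.single (.inl v₀) 1)
  refine key n ⟨fun mu => (mu - lam) • H mu, by fun_prop, ?_⟩
  filter_upwards [h] with mu hmu
  rw [map_smul, hmu, smul_smul, pow_succ']

lemma eventually_TW_eq {B : Finset G.V} {lam : ℂ} {l : B} {n : ℕ} {H : ℂ → (G.V ⊕ G.E → ℂ)}
    (h : ∀ᶠ mu in 𝓝[≠] lam,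
      G.vertexOp mu (H mu) = (mu - lam) ^ n • Pi.single (.inl (l : G.V)) 1) :
    ∀ᶠ mu in 𝓝[≠] lam, ∀ k : B, G.TW B mu k l = ((mu - lam) ^ n)⁻¹ * H mu (.inl k) := by
  filter_upwards [h, eventually_vertexOp_injective lam, self_mem_nhdsWithin] with mu hmu hi hne k
  have hne : (mu - lam) ^ n ≠ 0 := pow_ne_zero _ (sub_ne_zero.2 hne)
  refine TW_apply hi k l (X := ((mu - lam) ^ n)⁻¹ • H mu) ?_
  rw [map_smul, hmu, inv_smul_smul₀ hne]

theorem meromorphicOn_TW (B : Finset G.V) (k l : B) :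
    MeromorphicOn (fun mu => G.TW B mu k l) Set.univ := by
  intro lam _
  obtain ⟨n, H, hH, h, -⟩ :=
    exists_analyticAt_preimage (G := G) lam (Pi.single (.inl (l : G.V)) 1)
  have hm : MeromorphicAt (fun mu => ((mu - lam) ^ n)⁻¹ * H mu (.inl k)) lam := by
    refine MeromorphicAt.mul (MeromorphicAt.inv ?_) ?_
    · exact AnalyticAt.meromorphicAt (by fun_prop)
    · exact ((analyticAt_pi_iff.1 hH) _).meromorphicAt
  exact hm.congr ((eventually_TW_eq h).mono fun mu hmu => (hmu k).symm)

lemma tendsto_sub_pow_smul_TW {B : Finset G.V} {lam : ℂ} {n : ℕ}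
    {H : B → ℂ → (G.V ⊕ G.E → ℂ)} (hH : ∀ l, ContinuousAt (H l) lam)
    (h : ∀ l : B, ∀ᶠ mu in 𝓝[≠] lam,
      G.vertexOp mu (H l mu) = (mu - lam) ^ n • Pi.single (.inl (l : G.V)) 1) (j : ℕ) :
    Tendsto (fun mu => (mu - lam) ^ (n + j) • G.TW B mu) (𝓝[≠] lam)
      (𝓝 ((0 : ℂ) ^ j • Matrix.of fun k l : B => H l lam (.inl k))) := by
  refine tendsto_pi_nhds.2 fun k => tendsto_pi_nhds.2 fun l => ?_
  have h1 : Tendsto (fun mu => (mu - lam) ^ j * H l mu (.inl k)) (𝓝[≠] lam)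
      (𝓝 (0 ^ j * H l lam (.inl k))) := by
    have hc : ContinuousAt (fun mu => (mu - lam) ^ j * H l mu (.inl k)) lam :=
      ContinuousAt.mul (by fun_prop) ((continuousAt_pi.1 (hH l)) _)
    simpa using hc.tendsto.mono_left nhdsWithin_le_nhds
  refine h1.congr' ?_
  filter_upwards [eventually_TW_eq (h l), self_mem_nhdsWithin] with mu hmu hne
  have hne : (mu - lam) ^ n ≠ 0 := pow_ne_zero _ (sub_ne_zero.2 hne)
  rw [Matrix.smul_apply, hmu k, smul_eq_mul, pow_add]
  field_simp

theorem isPole_TW {B : Finset G.V} {lam : ℂ} (hp : isPole (G.TW B) lam) :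
    hasPoleOrder (G.TW B) lam 1 ∧ ∃ r : ℝ, (r : ℂ) = lam ∧ G.IsEigenvalue r := by
  obtain ⟨-, n, hn, ⟨A, hA, hAlim⟩, -⟩ := hp
  have hinj : ¬ Function.Injective (G.vertexOp lam) := fun hi => by
    choose N H hH h hN using fun l : B =>
      exists_analyticAt_preimage (G := G) lam (Pi.single (.inl (l : G.V)) 1)
    have h' := tendsto_sub_pow_smul_TW (fun l => (hH l).continuousAt)
      (fun l => by simpa only [hN l hi] using h l) n
    rw [zero_add, zero_pow (by lia), zero_smul] at h'
    exact hA (tendsto_nhds_unique hAlim h')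
  have him : lam.im = 0 := by
    by_contra him
    exact hinj (vertexOp_injective_of_im_ne_zero him)
  lift lam to ℝ using him
  refine ⟨?_, lam, rfl, isEigenvalue_iff.2 hinj⟩
  choose H hH h using fun l : B => exists_analyticAt_simple_pole lam (l : G.V)
  have ht := tendsto_sub_pow_smul_TW (fun l => (hH l).continuousAt) h
  refine ⟨⟨_, fun h0 => ?_, by simpa using ht 0⟩, by simpa using ht 1⟩
  obtain ⟨m, rfl⟩ := Nat.exists_eq_add_of_le hn
  have h' := ht m
  rw [h0, smul_zero] at h'
  exact hA (tendsto_nhds_unique hAlim h')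

/-! ### The residue -/

lemma matResidue_TW {B : Finset G.V} {lam : ℂ} {H : B → ℂ → (G.V ⊕ G.E → ℂ)}
    (hH : ∀ l, AnalyticAt ℂ (H l) lam)
    (h : ∀ l : B, ∀ᶠ mu in 𝓝[≠] lam,
      G.vertexOp mu (H l mu) = (mu - lam) ^ 1 • Pi.single (.inl (l : G.V)) 1) :
    matResidue (G.TW B) lam = Matrix.of fun k l : B => H l lam (.inl k) := by
  ext k l
  have hev : ∀ᶠ R in 𝓝[>] (0 : ℝ), (2 * (π : ℂ) * Complex.I)⁻¹ *
      circleIntegral (fun z => G.TW B z k l) lam R = H l lam (.inl k) := by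
    have ha : ∀ᶠ z in 𝓝 lam, AnalyticAt ℂ (fun z => H l z (.inl k)) z :=
      (analyticAt_pi_iff.1 (hH l) (.inl k)).eventually_analyticAt
    obtain ⟨r, hr, hball⟩ := Metric.eventually_nhds_iff_ball.1
      (ha.and (eventually_nhdsWithin_iff.1 (eventually_TW_eq (h l))))
    filter_upwards [Ioo_mem_nhdsGT hr] with R hR
    have hsub : ∀ z ∈ Metric.closedBall lam R, z ∈ Metric.ball lam r := fun z hz =>
      Metric.closedBall_subset_ball hR.2 hz
    have hcongr : circleIntegral (fun z => G.TW B z k l) lam R =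
        circleIntegral (fun z => (z - lam)⁻¹ • H l z (.inl k)) lam R := by
      refine circleIntegral.integral_congr hR.1.le fun z hz => ?_
      have hne : z ≠ lam := Metric.ne_of_mem_sphere hz hR.1.ne'
      simpa using (hball z (hsub z (Metric.sphere_subset_closedBall hz))).2 hne k
    rw [hcongr, ← smul_eq_mul]
    exact
      Complex.two_pi_I_inv_smul_circleIntegral_sub_inv_smul_of_differentiable_on_off_countable
        Set.countable_empty (Metric.mem_ball_self hR.1)
        (fun z hz => (hball z (hsub z hz)).1.continuousAt.continuousWithinAt)
        (fun z hz => (hball z (hsub z (Metric.ball_subset_closedBall hz.1))).1.differentiableAt)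
  have hex : ∃ c : ℂ, ∀ᶠ R in 𝓝[>] (0 : ℝ), (2 * (π : ℂ) * Complex.I)⁻¹ *
      circleIntegral (fun z => G.TW B z k l) lam R = c := ⟨_, hev⟩
  rw [matResidue, Matrix.of_apply, dif_pos hex]
  obtain ⟨R, h1, h2⟩ := (hex.choose_spec.and hev).exists
  exact h1.symm.trans h2

lemma pairing_sum_smul {ι : Type*} [Fintype ι] (mu lam : ℂ) (c : ι → ℂ)
    (X : ι → G.V ⊕ G.E → ℂ) (Y : G.V ⊕ G.E → ℂ) :
    G.pairing mu lam (∑ i, c i • X i) Y = ∑ i, c i * G.pairing mu lam (X i) Y := by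
  simp only [pairing, Finset.mul_sum]
  rw [Finset.sum_comm]
  refine Finset.sum_congr rfl fun e _ => ?_
  have hs : ∀ x, G.sol mu (∑ i, c i • X i) e x = ∑ i, c i * G.sol mu (X i) e x := fun x => by
    simp [map_sum, Finset.sum_apply]
  simp only [hs, Finset.sum_mul, mul_assoc]
  rw [intervalIntegral.integral_finsetSum (f := fun i x =>
    c i * (G.sol mu (X i) e x * G.sol lam Y e x)) fun i _ =>
    (continuous_const.mul
      ((G.contDiff_sol mu (X i) e).continuous.mul
        (G.contDiff_sol lam Y e).continuous)).intervalIntegrable _ _]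
  simp only [intervalIntegral.integral_const_mul]

theorem rank_matResidue_TW (B : Finset G.V) (lam : ℝ) :
    (matResidue (G.TW B) (lam : ℂ)).rank =
      Module.finrank ℂ (LinearMap.range (G.kerRestrict B lam)) := by
  choose H hH h using fun l : B => exists_analyticAt_simple_pole lam (l : G.V)
  rw [matResidue_TW hH h]
  set R : Matrix B B ℂ := Matrix.of fun k l : B => H l lam (.inl k) with hR
  have hK : ∀ l, G.vertexOp lam (H l lam) = 0 := fun l =>
    vertexOp_apply_of_tendsto (n := 0) (hH l).continuousAt (h l)
  have hKsum : ∀ w : B → ℂ, G.vertexOp lam (∑ l, w l • H l lam) = 0 := fun w => by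
    simp [map_sum, hK]
  have hpair : ∀ (w : B → ℂ) (Y : G.V ⊕ G.E → ℂ), G.vertexOp lam Y = 0 →
      G.pairing lam lam (∑ l, w l • H l lam) (star Y) = -∑ l, w l * star (Y (.inl l)) := by
    intro w Y hY
    rw [pairing_sum_smul, ← Finset.sum_neg_distrib]
    refine Finset.sum_congr rfl fun l _ => ?_
    rw [pairing_apply_of_tendsto (n := 0) (hH l).continuousAt (h l) (vertexOp_star_eq_zero hY)]
    simp
  have hRw : ∀ w : B → ℂ, R.mulVecLin w = G.kerRestrict B lam ⟨_, hKsum w⟩ := fun w => by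
    ext k
    change R.mulVec w k = (∑ l, w l • H l lam) (.inl k)
    simp [Matrix.mulVec, dotProduct, hR, Finset.sum_apply, mul_comm]
  suffices hrange : LinearMap.range R.mulVecLin = LinearMap.range (G.kerRestrict B lam) by
    rw [Matrix.rank, hrange]
  refine le_antisymm ?_ fun y hy => ?_
  · rintro _ ⟨w, rfl⟩
    exact ⟨_, (hRw w).symm⟩
  · by_contra hny
    obtain ⟨f, hfy, hf⟩ := Submodule.exists_le_ker_of_notMem hny
    have hfs : ∀ x : B → ℂ, f x = ∑ l, x l * f (Pi.single l 1) := fun x => by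
      rw [f.pi_apply_eq_sum_univ x]
      refine Finset.sum_congr rfl fun l _ => ?_
      rw [smul_eq_mul]
      congr 2
      ext j
      simp [Pi.single_apply, eq_comm]
    set w : B → ℂ := fun l => star (f (Pi.single l 1))
    have hpw : ∀ Y (hY : G.vertexOp lam Y = 0), G.pairing lam lam (∑ l, w l • H l lam) (star Y) =
        -star (f (G.kerRestrict B lam ⟨Y, hY⟩)) := fun Y hY => by
      rw [hpair w Y hY, hfs, star_sum]
      refine congrArg _ (Finset.sum_congr rfl fun l _ => ?_)
      rw [star_mul', mul_comm]
      rfl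
    have h0 : ∑ l, w l • H l lam = 0 := by
      refine eq_zero_of_pairing_self_eq_zero (hKsum w) ?_
      have hfw : f (R.mulVecLin w) = 0 := hf ⟨w, rfl⟩
      rw [hpw _ (hKsum w), ← hRw, hfw, star_zero, neg_zero]
    obtain ⟨⟨Y, hY⟩, rfl⟩ := hy
    have h1 := hpw Y hY
    rw [h0] at h1
    have h2 : G.pairing lam lam 0 (star Y) = 0 := by simp [pairing]
    rw [h2, eq_comm, neg_eq_zero, star_eq_zero] at h1
    exact hfy h1

end MetricGraph

/-- Proposition `prop:M`: the Titchmarsh--Weyl function `μ ↦ M_B(μ)`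
is meromorphic on `ℂ`, its poles are of order one and are eigenvalues of `-Δ_G`, and
for every `λ ∈ ℝ` one has `dim ker(-Δ_G - λ) = rank Res_λ M_B + dim R_B(G, λ)`. -/
theorem statement_10 (G : MetricGraph) (B : Finset G.V) (hB : B.Nonempty) :
    (∀ k l : B, MeromorphicOn (fun mu => G.TW B mu k l) Set.univ) ∧
    (∀ lam : ℂ, isPole (G.TW B) lam →
      hasPoleOrder (G.TW B) lam 1 ∧ ∃ r : ℝ, (r : ℂ) = lam ∧ G.IsEigenvalue r) ∧
    (∀ lam : ℝ,
      G.dimKer lam = (matResidue (G.TW B) (lam : ℂ)).rank + G.dimResB (↑B) lam) := by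
  refine ⟨MetricGraph.meromorphicOn_TW B, fun _ => MetricGraph.isPole_TW, fun lam => ?_⟩
  rw [MetricGraph.dimKer_eq, MetricGraph.rank_matResidue_TW, MetricGraph.dimResB_eq,
    LinearMap.finrank_range_add_finrank_ker]
end
end
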